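/- arXiv:2109.03509 — 12 statements merged into one kernel-verified Lean document; each statement's English description precedes it below -/
import Mathlib

section
/- Let (X,Σ,m) be a complete, σ-finite measure space with m(X) > 0. Then there exists a lifting ℓ : Σ → Σ of the measure m. -/
open MeasureTheory Set Filter

/-- There is a largest element `A` of the `σ`-algebra that is almost disjoint from `E`. -/
lemma exists_maximal_ae_disjoint {X : Type*} {s mX : MeasurableSpace X} {m : Measure X}
    [IsFiniteMeasure m] (hs : s ≤ mX) {E : Set X} (hE : MeasurableSet E) :
    ∃ A, MeasurableSet[s] A ∧ (∀ᵐ x ∂m, x ∈ A → x ∉ E) ∧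
      ∀ C, MeasurableSet[s] C → (∀ᵐ x ∂m, x ∈ C → x ∉ E) → C ≤ᵐ[m] A := by
  have hint : Integrable (E.indicator (1 : X → ℝ)) m := (integrable_const 1).indicator hE
  have hnn : 0 ≤ᵐ[m] m[E.indicator (1 : X → ℝ) | s] :=
    condExp_nonneg (Eventually.of_forall fun x => indicator_nonneg (by simp) x)
  have hA : MeasurableSet[s] {x | (m[E.indicator (1 : X → ℝ) | s]) x ≤ 0} :=
    measurableSet_le stronglyMeasurable_condExp.measurable measurable_const
  refine ⟨_, hA, ?_, fun C hC hCE => ?_⟩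
  · have h1 := setIntegral_condExp hs hint hA
    have h2 : ∫ x in {x | (m[E.indicator (1 : X → ℝ) | s]) x ≤ 0},
        E.indicator (1 : X → ℝ) x ∂m = 0 := by
      refine le_antisymm ?_ (integral_nonneg fun x => indicator_nonneg (by simp) x)
      rw [← h1]
      exact setIntegral_nonpos (hs _ hA) fun x hx => hx
    rw [integral_eq_zero_iff_of_nonneg (fun x => indicator_nonneg (by simp) x)
      hint.integrableOn] at h2
    filter_upwards [(ae_restrict_iff' (hs _ hA)).1 h2] with x hx hxA hxE
    simpa [hxE] using hx hxA
  · have h1 := setIntegral_condExp hs hint hC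
    have h2 : ∫ x in C, E.indicator (1 : X → ℝ) x ∂m = 0 := by
      apply integral_eq_zero_of_ae
      refine (ae_restrict_iff' (hs _ hC)).2 ?_
      filter_upwards [hCE] with x hx hxC
      simp [hx hxC]
    rw [h2, integral_eq_zero_iff_of_nonneg_ae (ae_restrict_of_ae hnn)
      integrable_condExp.integrableOn] at h1
    filter_upwards [(ae_restrict_iff' (hs _ hC)).1 h1] with x hx hxC
    exact (hx hxC).le

/-- A lifting of the measure `m` on a sub-`σ`-algebra, encoded by the family of ultrafilters
`U x = {A | x ∈ ℓ A}`. -/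
structure PartialLifting {X : Type*} [mX : MeasurableSpace X] (m : Measure X) where
  space : MeasurableSpace X
  space_le : space ≤ mX
  U : X → Ultrafilter X
  U_le : ∀ x, (U x : Filter X) ≤ ae m
  ae_mem : ∀ A, MeasurableSet[space] A → ∀ᵐ x ∂m, x ∈ A → A ∈ U x

namespace PartialLifting

variable {X : Type*} [mX : MeasurableSpace X] {m : Measure X}

instance : Preorder (PartialLifting m) where
  le P Q := P.space ≤ Q.space ∧ ∀ x A, MeasurableSet[P.space] A → A ∈ P.U x → A ∈ Q.U x
  le_refl P := ⟨le_rfl, fun _ _ _ h => h⟩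
  le_trans P Q R h h' := ⟨h.1.trans h'.1, fun x A hA hx => h'.2 x A (h.1 A hA) (h.2 x A hA hx)⟩

/-- The filter generated by the conull sets and the members of `P.U x` lying in `P.space`. -/
def restr (P : PartialLifting m) (x : X) : Filter X where
  sets := {S | ∃ A, MeasurableSet[P.space] A ∧ A ∈ P.U x ∧ A ≤ᵐ[m] S}
  univ_sets := ⟨univ, MeasurableSet.univ, univ_mem, EventuallyLE.refl _ _⟩
  sets_of_superset := by
    rintro S T ⟨A, hA, hx, hS⟩ hST
    exact ⟨A, hA, hx, hS.trans hST.eventuallyLE⟩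
  inter_sets := by
    rintro S T ⟨A, hA, hx, hS⟩ ⟨B, hB, hx', hT⟩
    exact ⟨A ∩ B, hA.inter hB, inter_mem hx hx', hS.inter hT⟩

lemma mem_restr {P : PartialLifting m} {x : X} {S : Set X} :
    S ∈ P.restr x ↔ ∃ A, MeasurableSet[P.space] A ∧ A ∈ P.U x ∧ A ≤ᵐ[m] S := Iff.rfl

lemma mem_restr_of_mem {P : PartialLifting m} {x : X} {A : Set X}
    (hA : MeasurableSet[P.space] A) (hx : A ∈ P.U x) : A ∈ P.restr x :=
  ⟨A, hA, hx, EventuallyLE.refl _ _⟩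

lemma mem_U_of_ae_le (P : PartialLifting m) {x : X} {A S : Set X} (hA : A ∈ P.U x)
    (h : A ≤ᵐ[m] S) : S ∈ P.U x := by
  filter_upwards [P.U_le x h, hA] with y hy hyA using hy hyA

lemma U_le_restr (P : PartialLifting m) (x : X) : (P.U x : Filter X) ≤ P.restr x := by
  rintro S ⟨A, -, hA, h⟩
  exact P.mem_U_of_ae_le hA h

instance (P : PartialLifting m) (x : X) : (P.restr x).NeBot :=
  NeBot.mono (P.U x).neBot (P.U_le_restr x)

lemma restr_le_ae (P : PartialLifting m) (x : X) : P.restr x ≤ ae m := by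
  intro S hS
  refine ⟨univ, MeasurableSet.univ, univ_mem, ?_⟩
  filter_upwards [hS] with y hy _ using hy

lemma restr_anti {P Q : PartialLifting m} (h : P ≤ Q) (x : X) : Q.restr x ≤ P.restr x := by
  rintro S ⟨A, hA, hx, hS⟩
  exact ⟨A, h.1 A hA, h.2 x A hA hx, hS⟩

lemma le_of_U_le_restr {P Q : PartialLifting m} (h : P.space ≤ Q.space)
    (hU : ∀ x, (Q.U x : Filter X) ≤ P.restr x) : P ≤ Q :=
  ⟨h, fun x _ hA hx => hU x (mem_restr_of_mem hA hx)⟩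

instance [NeZero m] : Nonempty (PartialLifting m) := by
  have : (ae m).NeBot := ae_neBot.2 (NeZero.ne m)
  refine ⟨⟨⊥, bot_le, fun _ => Ultrafilter.of (ae m), fun _ => Ultrafilter.of_le _, ?_⟩⟩
  intro A hA
  rcases MeasurableSpace.measurableSet_bot_iff.1 hA with rfl | rfl
  · simp
  · exact Eventually.of_forall fun _ _ => univ_mem

/-! ### Adjoining one set -/

/-- The `σ`-algebra generated by a `σ`-algebra and one further set. -/
@[reducible]
def adjoinSpace (s : MeasurableSpace X) (E : Set X) : MeasurableSpace X where
  MeasurableSet' D := ∃ A B, MeasurableSet[s] A ∧ MeasurableSet[s] B ∧ D = E.ite A B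
  measurableSet_empty := ⟨∅, ∅, MeasurableSet.empty, MeasurableSet.empty, by simp⟩
  measurableSet_compl := by
    rintro _ ⟨A, B, hA, hB, rfl⟩
    exact ⟨Aᶜ, Bᶜ, hA.compl, hB.compl, by ext y; by_cases y ∈ E <;> simp_all [Set.ite]⟩
  measurableSet_iUnion := by
    intro f hf
    choose A B hA hB hf using hf
    refine ⟨⋃ i, A i, ⋃ i, B i, MeasurableSet.iUnion hA, MeasurableSet.iUnion hB, ?_⟩
    ext y
    by_cases y ∈ E <;> simp_all [Set.ite]

lemma ae_neBot_restr_inf_principal [IsFiniteMeasure m] (P : PartialLifting m) {E : Set X}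
    (hE : MeasurableSet E) : ∀ᵐ x ∂m, x ∈ E → (P.restr x ⊓ 𝓟 E).NeBot := by
  obtain ⟨A, hA, hAE, hmax⟩ := exists_maximal_ae_disjoint (m := m) P.space_le hE
  filter_upwards [hAE, P.ae_mem _ hA.compl] with x hx hxA hxE
  rw [neBot_iff, Ne, ← disjoint_iff, disjoint_principal_right]
  rintro ⟨C, hC, hCx, hCE⟩
  exact (Ultrafilter.compl_mem_iff_notMem.1 (hxA fun h => hx h hxE))
    (P.mem_U_of_ae_le hCx (hmax C hC hCE))

lemma exists_adjoin [IsFiniteMeasure m] (P : PartialLifting m) {E : Set X}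
    (hE : MeasurableSet E) : ∃ Q, P ≤ Q ∧ MeasurableSet[Q.space] E := by
  have key : ∀ x, ∃ V : Ultrafilter X, (V : Filter X) ≤ P.restr x ∧
      (x ∈ E → (P.restr x ⊓ 𝓟 E).NeBot → E ∈ V) ∧
      (x ∈ Eᶜ → (P.restr x ⊓ 𝓟 Eᶜ).NeBot → Eᶜ ∈ V) := by
    intro x
    by_cases h1 : x ∈ E ∧ (P.restr x ⊓ 𝓟 E).NeBot
    · have := h1.2
      have h := Ultrafilter.of_le (P.restr x ⊓ 𝓟 E)
      exact ⟨_, h.trans inf_le_left, fun _ _ => le_principal_iff.1 (h.trans inf_le_right),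
        fun hx => absurd h1.1 hx⟩
    · by_cases h2 : x ∈ Eᶜ ∧ (P.restr x ⊓ 𝓟 Eᶜ).NeBot
      · have := h2.2
        have h := Ultrafilter.of_le (P.restr x ⊓ 𝓟 Eᶜ)
        exact ⟨_, h.trans inf_le_left, fun hx => absurd hx h2.1,
          fun _ _ => le_principal_iff.1 (h.trans inf_le_right)⟩
      · exact ⟨P.U x, P.U_le_restr x, fun hx h => absurd ⟨hx, h⟩ h1,
          fun hx h => absurd ⟨hx, h⟩ h2⟩
  choose V hV hVE hVE' using key
  refine ⟨⟨adjoinSpace P.space E, ?_, V, fun x => (hV x).trans (P.restr_le_ae x), ?_⟩,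
    le_of_U_le_restr ?_ hV, ?_⟩
  · rintro _ ⟨A, B, hA, hB, rfl⟩
    exact hE.ite (P.space_le _ hA) (P.space_le _ hB)
  · rintro _ ⟨A, B, hA, hB, rfl⟩
    filter_upwards [P.ae_mem A hA, P.ae_mem B hB, P.ae_neBot_restr_inf_principal hE,
      P.ae_neBot_restr_inf_principal hE.compl] with x hxA hxB hxE hxE' hx
    by_cases h : x ∈ E
    · have h1 : A ∈ V x := hV x (mem_restr_of_mem hA (hxA (by simpa [Set.ite, h] using hx)))
      filter_upwards [h1, hVE x h (hxE h)] with y hy hyE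
      exact Or.inl ⟨hy, hyE⟩
    · have h1 : B ∈ V x := hV x (mem_restr_of_mem hB (hxB (by simpa [Set.ite, h] using hx)))
      filter_upwards [h1, hVE' x h (hxE' h)] with y hy hyE
      exact Or.inr ⟨hy, hyE⟩
  · exact fun A hA => ⟨A, A, hA, hA, by simp⟩
  · exact ⟨univ, ∅, @MeasurableSet.univ X P.space, @MeasurableSet.empty X P.space,
      by simp [Set.ite]⟩

/-! ### Upper bounds of chains -/

/-- The lower density attached to an increasing sequence of partial liftings: `B` has density one
at `x` if `x` belongs to the liftings of `{m[B | P n] > 1 - ε}` for all large `n`. -/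
def DensityOne (P : ℕ → PartialLifting m) (x : X) (B : Set X) : Prop :=
  ∀ ε : ℝ, 0 < ε → ∀ᶠ n in atTop,
    {y | 1 - ε < (m[B.indicator (1 : X → ℝ) | (P n).space]) y} ∈ (P n).U x

lemma not_densityOne_of_ae_empty {P : ℕ → PartialLifting m} {x : X} {A : Set X}
    (hA : A =ᵐ[m] (∅ : Set X)) :
    ¬ DensityOne P x A := by
  intro h
  obtain ⟨n, hn⟩ := (h 1 one_pos).exists
  have h1 : m[A.indicator (1 : X → ℝ) | (P n).space] =ᵐ[m] m[(0 : X → ℝ) | (P n).space] :=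
    condExp_congr_ae (by simpa [Pi.zero_def] using indicator_ae_eq_of_ae_eq_set (f := (1 : X → ℝ)) hA)
  have : ∀ᶠ y in ((P n).U x : Filter X), False := by
    filter_upwards [hn, (P n).U_le x h1] with y hy h
    simp [h] at hy
  exact (P n).U x |>.neBot.ne (empty_mem_iff_bot.1 this)

section DensityOne

variable [IsFiniteMeasure m] {P : ℕ → PartialLifting m} {x : X} {A B : Set X}

lemma integrable_indicator_one (hA : MeasurableSet A) :
    Integrable (A.indicator (1 : X → ℝ)) m := (integrable_const 1).indicator hA

lemma DensityOne.inter (hA : MeasurableSet A) (hB : MeasurableSet B)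
    (hxA : DensityOne P x A) (hxB : DensityOne P x B) : DensityOne P x (A ∩ B) := by
  intro ε hε
  filter_upwards [hxA (ε / 2) (by positivity), hxB (ε / 2) (by positivity)] with n hnA hnB
  have h1 : m[A.indicator (1 : X → ℝ) + B.indicator (1 : X → ℝ) | (P n).space] ≤ᵐ[m]
      m[(A ∩ B).indicator (1 : X → ℝ) + 1 | (P n).space] := by
    refine condExp_mono ((integrable_indicator_one hA).add (integrable_indicator_one hB))
      ((integrable_indicator_one (hA.inter hB)).add (integrable_const 1))
      (Eventually.of_forall fun y => ?_)
    by_cases hyA : y ∈ A <;> by_cases hyB : y ∈ B <;> simp [hyA, hyB]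
  have h2 := condExp_add (integrable_indicator_one (m := m) hA)
    (integrable_indicator_one hB) (P n).space
  have h3 := condExp_add (integrable_indicator_one (m := m) (hA.inter hB))
    (integrable_const (1 : ℝ)) (P n).space
  have h4 := condExp_const (μ := m) (P n).space_le (1 : ℝ)
  filter_upwards [hnA, hnB, (P n).U_le x h1, (P n).U_le x h2, (P n).U_le x h3]
    with y hyA hyB h1 h2 h3
  simp only [Pi.add_apply, h4] at *
  change _ ≤ (m[(A ∩ B).indicator (1 : X → ℝ) + (fun _ => 1) | (P n).space]) y at h1
  linarith

lemma densityOne_of_mem (hP : Monotone P) {n : ℕ} (hA : MeasurableSet[(P n).space] A)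
    (hx : A ∈ (P n).U x) : DensityOne P x A := by
  intro ε hε
  filter_upwards [eventually_ge_atTop n] with k hk
  have hAk : MeasurableSet[(P k).space] A := (hP hk).1 A hA
  rw [condExp_of_stronglyMeasurable (P k).space_le
    ((@stronglyMeasurable_one X ℝ (P k).space _ _).indicator hAk)
    (integrable_indicator_one ((P k).space_le A hAk))]
  filter_upwards [(hP hk).2 x A hA hx] with y hy
  simp [hy, hε]

lemma ae_densityOne (hP : Monotone P) (hA : MeasurableSet[⨆ n, (P n).space] A) :
    ∀ᵐ x ∂m, x ∈ A → DensityOne P x A := by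
  let ℱ : Filtration ℕ mX := ⟨fun n => (P n).space, fun i j h => (hP h).1, fun n => (P n).space_le⟩
  have hle : (⨆ n, (P n).space) ≤ mX := iSup_le fun n => (P n).space_le
  have hlim := tendsto_ae_condExp (μ := m) (ℱ := ℱ) (A.indicator (1 : X → ℝ))
  have hmem : ∀ᵐ x ∂m, ∀ n k : ℕ,
      x ∈ {y | 1 - 1 / ((k : ℝ) + 1) < (m[A.indicator (1 : X → ℝ) | (P n).space]) y} →
      {y | 1 - 1 / ((k : ℝ) + 1) < (m[A.indicator (1 : X → ℝ) | (P n).space]) y} ∈ (P n).U x :=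
    ae_all_iff.2 fun n => ae_all_iff.2 fun k => (P n).ae_mem _
      (measurableSet_lt measurable_const stronglyMeasurable_condExp.measurable)
  filter_upwards [hlim, hmem] with x hx hxU hxA ε hε
  have h1 : m[A.indicator (1 : X → ℝ) | ⨆ n, ℱ n] = A.indicator 1 :=
    condExp_of_stronglyMeasurable hle ((@stronglyMeasurable_one X ℝ (⨆ n, (P n).space) _ _).indicator hA)
      (integrable_indicator_one (hle A hA))
  rw [h1, indicator_of_mem hxA] at hx
  obtain ⟨k, hk⟩ := exists_nat_one_div_lt hε
  have hk0 : (0 : ℝ) < 1 / ((k : ℝ) + 1) := by positivity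
  filter_upwards [hx.eventually (lt_mem_nhds (show 1 - 1 / ((k : ℝ) + 1) < (1 : X → ℝ) x by
    simpa using hk0))] with n hn
  filter_upwards [hxU n k hn] with y hy
  exact lt_trans (by linarith) hy

end DensityOne

lemma exists_upperBound_of_monotone [IsFiniteMeasure m] {P : ℕ → PartialLifting m}
    (hP : Monotone P) : ∃ Q, ∀ n, P n ≤ Q := by
  let F : X → Filter X := fun x =>
    { sets := {S | ∃ B, MeasurableSet B ∧ DensityOne P x B ∧ B ≤ᵐ[m] S}
      univ_sets := ⟨univ, MeasurableSet.univ,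
        densityOne_of_mem hP (n := 0) MeasurableSet.univ univ_mem, EventuallyLE.refl _ _⟩
      sets_of_superset := by
        rintro S T ⟨B, hB, hx, hS⟩ hST
        exact ⟨B, hB, hx, hS.trans hST.eventuallyLE⟩
      inter_sets := by
        rintro S T ⟨A, hA, hx, hS⟩ ⟨B, hB, hx', hT⟩
        exact ⟨A ∩ B, hA.inter hB, hx.inter hA hB hx', hS.inter hT⟩ }
  have hF : ∀ x, (F x).NeBot := by
    intro x
    rw [neBot_iff, Ne, ← empty_mem_iff_bot]
    rintro ⟨B, -, hx, hB⟩
    exact not_densityOne_of_ae_empty (hB.antisymm (empty_subset B).eventuallyLE) hx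
  have hle : (⨆ n, (P n).space) ≤ mX := iSup_le fun n => (P n).space_le
  refine ⟨⟨⨆ n, (P n).space, hle, fun x => Ultrafilter.of (F x), fun x => ?_, fun A hA => ?_⟩,
    fun n => ⟨le_iSup (fun n => (P n).space) n, fun x A hA hx => ?_⟩⟩
  · refine (Ultrafilter.of_le (F x)).trans fun S hS => ?_
    refine ⟨univ, MeasurableSet.univ,
      densityOne_of_mem hP (n := 0) MeasurableSet.univ univ_mem, ?_⟩
    filter_upwards [hS] with y hy _ using hy
  · filter_upwards [ae_densityOne hP hA] with x hx hxA
    exact Ultrafilter.of_le (F x) ⟨A, hle A hA, hx hxA, EventuallyLE.refl _ _⟩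
  · exact Ultrafilter.of_le (F x) ⟨A, (P n).space_le A hA, densityOne_of_mem hP hA hx,
      EventuallyLE.refl _ _⟩

lemma exists_upperBound_of_countably_directed {c : Set (PartialLifting m)}
    (hne : c.Nonempty) (hdir : ∀ p : ℕ → c, ∃ Q ∈ c, ∀ n, (p n : PartialLifting m) ≤ Q) :
    ∃ Q, ∀ P ∈ c, P ≤ Q := by
  have : Nonempty c := hne.to_subtype
  have hF : ∀ x, (⨅ P : c, (P : PartialLifting m).restr x).NeBot := by
    intro x
    refine iInf_neBot_of_directed' ?_ fun P => inferInstance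
    intro P P'
    obtain ⟨Q, hQ, hle⟩ := hdir fun n => if n = 0 then P else P'
    exact ⟨⟨Q, hQ⟩, restr_anti (by simpa using hle 0) x, restr_anti (by simpa using hle 1) x⟩
  have hV : ∀ x, ∀ P ∈ c,
      (Ultrafilter.of (⨅ P : c, (P : PartialLifting m).restr x) : Filter X) ≤ P.restr x :=
    fun x P hP => (Ultrafilter.of_le _).trans (iInf_le _ (⟨P, hP⟩ : c))
  refine ⟨⟨
    { MeasurableSet' := fun A => ∃ P ∈ c, MeasurableSet[P.space] A
      measurableSet_empty := ⟨_, hne.some_mem, @MeasurableSet.empty X hne.some.space⟩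
      measurableSet_compl := fun A ⟨P, hP, hA⟩ => ⟨P, hP, hA.compl⟩
      measurableSet_iUnion := by
        intro f hf
        choose P hP hf using hf
        obtain ⟨Q, hQ, hle⟩ := hdir fun n => ⟨P n, hP n⟩
        exact ⟨Q, hQ, MeasurableSet.iUnion fun n => (hle n).1 _ (hf n)⟩ },
    ?_, fun x => Ultrafilter.of (⨅ P : c, (P : PartialLifting m).restr x), ?_, ?_⟩,
    fun P hP => le_of_U_le_restr (fun A hA => ⟨P, hP, hA⟩) fun x => hV x P hP⟩
  · rintro A ⟨P, -, hA⟩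
    exact P.space_le A hA
  · exact fun x => (hV x _ hne.some_mem).trans (restr_le_ae _ x)
  · rintro A ⟨P, hP, hA⟩
    filter_upwards [P.ae_mem A hA] with x hx hxA
    exact hV x P hP (mem_restr_of_mem hA (hx hxA))

lemma bddAbove_of_isChain [IsFiniteMeasure m] {c : Set (PartialLifting m)}
    (hc : IsChain (· ≤ ·) c) (hne : c.Nonempty) : BddAbove c := by
  by_cases h : ∃ p : ℕ → c, ∀ Q ∈ c, ∃ n, Q ≤ p n
  · obtain ⟨p, hp⟩ := h
    have hd : Directed (· ≤ ·) fun n => (p n : PartialLifting m) := by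
      intro i j
      rcases hc.total (p i).2 (p j).2 with h | h
      · exact ⟨j, h, le_rfl⟩
      · exact ⟨i, le_rfl, h⟩
    obtain ⟨Q, hQ⟩ := exists_upperBound_of_monotone hd.sequence_mono
    refine ⟨Q, fun R hR => ?_⟩
    obtain ⟨n, hn⟩ := hp R hR
    exact (hn.trans (hd.le_sequence n)).trans (hQ _)
  · push Not at h
    refine exists_upperBound_of_countably_directed hne fun p => ?_
    obtain ⟨Q, hQ, h⟩ := h p
    exact ⟨Q, hQ, fun n => (hc.total (p n).2 hQ).resolve_right (h n)⟩

lemma exists_space_eq [IsFiniteMeasure m] [NeZero m] : ∃ P : PartialLifting m, P.space = mX := by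
  obtain ⟨P, hP⟩ := zorn_le_nonempty fun (c : Set (PartialLifting m)) hc hne =>
    bddAbove_of_isChain hc hne
  refine ⟨P, le_antisymm P.space_le fun E hE => ?_⟩
  obtain ⟨Q, hPQ, hQ⟩ := P.exists_adjoin hE
  exact (hP hPQ).1 E hQ

lemma ae_eq_setOf_mem_U (P : PartialLifting m) {A : Set X} (hA : MeasurableSet[P.space] A) :
    A =ᵐ[m] {x | A ∈ P.U x} := by
  filter_upwards [P.ae_mem A hA, P.ae_mem _ hA.compl] with x hx hx'
  refine propext ⟨hx, fun h => ?_⟩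
  by_contra hn
  exact Ultrafilter.compl_mem_iff_notMem.1 (hx' hn) h

end PartialLifting

/-- **Existence of liftings (von Neumann–Maharam).**
Let `(X, Σ, m)` be a complete, σ-finite measure space with `m(X) > 0`. Then there exists a
lifting `ℓ : Σ → Σ` of the measure `m`, i.e. a map sending measurable sets to measurable sets
which is a Boolean homomorphism (`ℓ ∅ = ∅`, `ℓ X = X`, `ℓ (A ∆ B) = ℓ A ∆ ℓ B`,
`ℓ (A ∩ B) = ℓ A ∩ ℓ B`), sends `m`-null sets to `∅`, and satisfies `m (A ∆ ℓ A) = 0`. -/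
theorem exists_lifting {X : Type*} [MeasurableSpace X] (m : Measure X)
    [SigmaFinite m] (hcomplete : m.IsComplete) (hpos : 0 < m Set.univ) :
    ∃ ℓ : Set X → Set X,
      (∀ A, MeasurableSet A → MeasurableSet (ℓ A)) ∧
      ℓ ∅ = ∅ ∧
      ℓ Set.univ = Set.univ ∧
      (∀ A B, MeasurableSet A → MeasurableSet B →
        ℓ (symmDiff A B) = symmDiff (ℓ A) (ℓ B)) ∧
      (∀ A B, MeasurableSet A → MeasurableSet B → ℓ (A ∩ B) = ℓ A ∩ ℓ B) ∧
      (∀ N, MeasurableSet N → m N = 0 → ℓ N = ∅) ∧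
      (∀ A, MeasurableSet A → m (symmDiff A (ℓ A)) = 0) := by
  have hm : m ≠ 0 := by
    rintro rfl
    simp at hpos
  have : NeZero m.toFinite := ⟨by simpa using hm⟩
  obtain ⟨P, hP⟩ := PartialLifting.exists_space_eq (m := m.toFinite)
  have hae : ∀ A, MeasurableSet A → A =ᵐ[m] {x | A ∈ P.U x} := by
    intro A hA
    rw [← ae_toFinite]
    exact P.ae_eq_setOf_mem_U (by rwa [hP])
  refine ⟨fun A => {x | A ∈ P.U x}, fun A hA => ?_, ?_, ?_, fun A B _ _ => ?_, fun A B _ _ => ?_,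
    fun N _ hN => ?_, fun A hA => ?_⟩
  · exact (hA.nullMeasurableSet.congr (hae A hA)).measurable_of_complete
  · simp
  · exact eq_univ_of_forall fun x => univ_mem
  · ext x
    change symmDiff A B ∈ P.U x ↔ (A ∈ P.U x ∧ B ∉ P.U x) ∨ (B ∈ P.U x ∧ A ∉ P.U x)
    rw [Set.symmDiff_def, Ultrafilter.union_mem_iff, Ultrafilter.sdiff_mem_iff,
      Ultrafilter.sdiff_mem_iff]
  · ext x
    exact inter_mem_iff
  · refine eq_empty_of_forall_notMem fun x =>
      Ultrafilter.compl_mem_iff_notMem.1 (P.U_le x ?_)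
    rw [ae_toFinite]
    exact compl_mem_ae_iff.2 hN
  · exact measure_symmDiff_eq_zero_iff.2 (hae A hA)
end

section
/- Let (X,Σ) be a measurable space, let (Y,d_Y) and (Z,d_Z) be separable metric spaces with (Y,d_Y) compact, let φ : X ⇉ Z be a measurable correspondence, and let ψ : Y → Z be a continuous map. Define the preimage correspondence ψ⁻¹(φ) : X ⇉ Y by ψ⁻¹(φ)(x) := ψ⁻¹(φ(x)) for every x ∈ X. Then ψ⁻¹(φ) is a measurable correspondence. -/
open Set

/-- **Preimages of measurable correspondences.**
Let `(X, Σ)` be a measurable space, `Y`, `Z` separable metric spaces with `Y` compact,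
`φ : X ⇉ Z` a measurable correspondence and `ψ : Y → Z` a continuous map. Then the preimage
correspondence `x ↦ ψ⁻¹(φ(x))` is a measurable correspondence. -/
theorem preimage_correspondence_measurable
    {X Y Z : Type*} [MeasurableSpace X]
    [MetricSpace Y] [TopologicalSpace.SeparableSpace Y] [CompactSpace Y]
    [MetricSpace Z] [TopologicalSpace.SeparableSpace Z]
    (φ : X → Set Z)
    (hφ : ∀ C : Set Z, IsClosed C → MeasurableSet {x | (φ x ∩ C).Nonempty})
    (ψ : Y → Z) (hψ : Continuous ψ) :
    ∀ C : Set Y, IsClosed C → MeasurableSet {x | (ψ ⁻¹' (φ x) ∩ C).Nonempty} := by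
  intro C hC
  have hset : {x | (ψ ⁻¹' (φ x) ∩ C).Nonempty} = {x | (φ x ∩ ψ '' C).Nonempty} := by
    ext x
    rw [mem_ofPred_eq, mem_ofPred_eq, inter_comm (φ x), image_inter_nonempty_iff, inter_comm]
  rw [hset]
  exact hφ _ (hC.isCompact.image hψ).isClosed
end

section
/- (Banach–Mazur) Let E be a separable real Banach space. Then there exists a linear isometric embedding I : E → C([0,1]), where C([0,1]) is the Banach space of continuous real-valued functions on [0,1] equipped with the supremum norm. -/
open MeasureTheory Set Topology

/-- There is a continuous family of real sequences indexed by `[0,1]` whose members encode every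
binary sequence, with `true` encoded as `2` and `false` as `-1`. -/
theorem exists_continuous_unitInterval_encoding_nat_bool :
    ∃ p : C(Icc (0 : ℝ) 1, ℕ → ℝ), ∀ b : ℕ → Bool, ∃ t, ∀ k, p t k = if b k then 2 else -1 := by
  let e : (ℕ → Bool) → Icc (0 : ℝ) 1 :=
    inclusion cantorSet_subset_unitInterval ∘ cantorSetHomeomorphNatToBool.symm
  have he : IsClosedEmbedding e := by
    refine Continuous.isClosedEmbedding ?_ ?_
    · exact (continuous_inclusion _).comp cantorSetHomeomorphNatToBool.symm.continuous
    · exact (inclusion_injective _).comp cantorSetHomeomorphNatToBool.symm.injective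
  let q : C(ℕ → Bool, ℕ → ℝ) :=
    ⟨fun b k ↦ if b k then 2 else -1, continuous_pi fun k ↦
      (continuous_of_discreteTopology (f := fun c : Bool ↦ if c then (2 : ℝ) else -1)).comp
        (continuous_apply k)⟩
  obtain ⟨p, hp⟩ := ContinuousMap.exists_extension he q
  exact ⟨p, fun b ↦ ⟨e b, fun k ↦ congrFun (DFunLike.congr_fun hp b) k⟩⟩

/-- Thresholding a real sequence at the level `u`. -/
noncomputable def thresholdBits (x : ℕ → ℝ) (u : unitInterval) : ℕ → Bool :=
  fun k ↦ decide ((u : ℝ) < x k)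

theorem thresholdBits_of_eq_ite {x : ℕ → ℝ} {b : ℕ → Bool}
    (h : ∀ k, x k = if b k then 2 else -1) (u : unitInterval) : thresholdBits x u = b := by
  funext k
  have h0 := u.2.1
  have h1 := u.2.2
  cases hb : b k <;> simp [thresholdBits, h, hb] <;> linarith

theorem measurable_thresholdBits (x : ℕ → ℝ) : Measurable (thresholdBits x) :=
  measurable_pi_lambda _ fun k ↦ measurable_to_bool <| by
    simpa [thresholdBits, preimage] using
      measurableSet_lt (measurable_subtype_coe (p := (· ∈ unitInterval)))
        (measurable_const (a := x k))

theorem continuousAt_thresholdBits {x : ℕ → ℝ} {u : unitInterval} (h : ∀ k, (u : ℝ) ≠ x k) :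
    ContinuousAt (fun y ↦ thresholdBits y u) x := by
  refine continuousAt_pi.2 fun k ↦ ?_
  have hx : Filter.Tendsto (fun y : ℕ → ℝ ↦ y k) (𝓝 x) (𝓝 (x k)) :=
    (continuous_apply k).continuousAt
  refine ContinuousAt.congr (f := fun _ ↦ decide ((u : ℝ) < x k)) continuousAt_const ?_
  rcases (h k).lt_or_gt with hlt | hgt
  · filter_upwards [hx.eventually_const_lt hlt] with y hy
    simp [thresholdBits, hlt, hy]
  · filter_upwards [hx.eventually_lt_const hgt] with y hy
    simp [thresholdBits, hgt.not_gt, hy.not_gt]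

theorem integrable_comp_thresholdBits (g : C(ℕ → Bool, ℝ)) (x : ℕ → ℝ) :
    Integrable fun u ↦ g (thresholdBits x u) :=
  Integrable.of_bound
    (g.continuous.measurable.comp (measurable_thresholdBits x)).aestronglyMeasurable ‖g‖
    (.of_forall fun _ ↦ g.norm_coe_le_norm _)

theorem continuous_integral_comp_thresholdBits (g : C(ℕ → Bool, ℝ)) :
    Continuous fun x : ℕ → ℝ ↦ ∫ u, g (thresholdBits x u) := by
  refine continuous_iff_continuousAt.2 fun x ↦ ?_
  refine continuousAt_of_dominated (bound := fun _ ↦ ‖g‖)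
    (.of_forall fun y ↦ (integrable_comp_thresholdBits g y).aestronglyMeasurable)
    (.of_forall fun y ↦ .of_forall fun _ ↦ g.norm_coe_le_norm _) (integrable_const _) ?_
  have hae : ∀ᵐ u : unitInterval, ∀ k, (u : ℝ) ≠ x k := by
    refine ae_all_iff.2 fun k ↦ measure_mono_null (t := {u : unitInterval | (u : ℝ) = x k})
      (fun u hu ↦ not_not.1 hu) ?_
    exact Set.Subsingleton.measure_zero
      (fun a ha b hb ↦ Subtype.ext (Eq.trans ha (Eq.symm hb))) _
  filter_upwards [hae] with u hu
  exact g.continuous.continuousAt.comp (continuousAt_thresholdBits hu)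

/-- Continuous functions on the Cantor space embed linearly and isometrically into `C([0,1])`. -/
theorem nonempty_linearIsometry_nat_bool_unitInterval :
    Nonempty (C(ℕ → Bool, ℝ) →ₗᵢ[ℝ] C(Icc (0 : ℝ) 1, ℝ)) := by
  obtain ⟨p, hp⟩ := exists_continuous_unitInterval_encoding_nat_bool
  let T : C(ℕ → Bool, ℝ) →ₗ[ℝ] C(Icc (0 : ℝ) 1, ℝ) :=
    { toFun := fun g ↦ ⟨fun t ↦ ∫ u, g (thresholdBits (p t) u),
        (continuous_integral_comp_thresholdBits g).comp p.continuous⟩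
      map_add' := fun f g ↦ ContinuousMap.ext fun t ↦
        integral_add (integrable_comp_thresholdBits f (p t))
          (integrable_comp_thresholdBits g (p t))
      map_smul' := fun c g ↦ ContinuousMap.ext fun t ↦ integral_const_mul c _ }
  refine ⟨⟨T, fun g ↦ le_antisymm ?_ ?_⟩⟩
  · refine (ContinuousMap.norm_le _ (norm_nonneg g)).2 fun t ↦ ?_
    simpa [T] using norm_integral_le_of_norm_le_const (μ := (volume : Measure unitInterval))
      (.of_forall fun u ↦ g.norm_coe_le_norm (thresholdBits (p t) u))
  · refine (ContinuousMap.norm_le _ (norm_nonneg _)).2 fun b ↦ ?_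
    obtain ⟨t, ht⟩ := hp b
    have hT : T g t = g b := by
      simp [T, thresholdBits_of_eq_ite ht]
    exact hT ▸ (T g).norm_coe_le_norm t

/-- A separable real normed space embeds linearly and isometrically into the continuous functions
on the Cantor space. -/
theorem nonempty_linearIsometry_continuousMap_nat_bool (E : Type*) [NormedAddCommGroup E]
    [NormedSpace ℝ E] [TopologicalSpace.SeparableSpace E] :
    Nonempty (E →ₗᵢ[ℝ] C(ℕ → Bool, ℝ)) := by
  let K : Set (WeakDual ℝ E) := WeakDual.toStrongDual ⁻¹' Metric.closedBall 0 1
  have hK : IsCompact K := WeakDual.isCompact_closedBall 0 1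
  have : CompactSpace K := isCompact_iff_compactSpace.1 hK
  have : TopologicalSpace.MetrizableSpace K := WeakDual.metrizable_of_isCompact ℝ E K hK
  let : MetricSpace K := TopologicalSpace.metrizableSpaceMetric K
  have : Nonempty K := ⟨⟨0, by simp [K]⟩⟩
  obtain ⟨φ, hφ, hsurj⟩ := exists_nat_bool_continuous_surjective_of_compact K
  let T : E →ₗ[ℝ] C(ℕ → Bool, ℝ) :=
    { toFun := fun x ↦ ⟨fun b ↦ (φ b : WeakDual ℝ E) x,
        (WeakDual.eval_continuous x).comp (continuous_subtype_val.comp hφ)⟩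
      map_add' := fun x y ↦ ContinuousMap.ext fun b ↦ map_add (φ b : WeakDual ℝ E) x y
      map_smul' := fun c x ↦ ContinuousMap.ext fun b ↦ map_smul (φ b : WeakDual ℝ E) c x }
  refine ⟨⟨T, fun x ↦ le_antisymm ?_ ?_⟩⟩
  · refine (ContinuousMap.norm_le _ (norm_nonneg x)).2 fun b ↦ ?_
    have hb : ‖WeakDual.toStrongDual (φ b : WeakDual ℝ E)‖ ≤ 1 :=
      mem_closedBall_zero_iff.1 (φ b).2
    exact (WeakDual.toStrongDual (φ b : WeakDual ℝ E)).le_of_opNorm_le hb x |>.trans_eq (one_mul _)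
  · obtain ⟨f, hf, hfx⟩ := exists_dual_vector'' ℝ x
    obtain ⟨b, hb⟩ := hsurj ⟨StrongDual.toWeakDual f, mem_closedBall_zero_iff.2 hf⟩
    have hT : T x b = ‖x‖ := by
      change (φ b : WeakDual ℝ E) x = ‖x‖
      rw [hb]
      exact hfx
    calc ‖x‖ = ‖T x b‖ := by rw [hT, norm_norm]
      _ ≤ ‖T x‖ := (T x).norm_coe_le_norm b

/-- **Banach–Mazur theorem.**
Every separable real Banach space `E` admits a linear isometric embedding into `C([0,1])`,
the Banach space of continuous real-valued functions on `[0,1]` with the supremum norm. -/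
theorem banach_mazur {E : Type*} [NormedAddCommGroup E] [NormedSpace ℝ E]
    [CompleteSpace E] [TopologicalSpace.SeparableSpace E] :
    Nonempty (E →ₗᵢ[ℝ] C(Set.Icc (0:ℝ) 1, ℝ)) := by
  obtain ⟨S⟩ := nonempty_linearIsometry_continuousMap_nat_bool E
  obtain ⟨T⟩ := nonempty_linearIsometry_nat_bool_unitInterval
  exact ⟨T.comp S⟩
end

section
/- Let (X,Σ) be a measurable space and 𝔹 a separable Banach space. Let (s_n)_{n∈ℕ} be a sequence of measurable maps s_n : X → 𝔹. Define E(x) := the closure in 𝔹 of the linear span of {s_n(x) : n ∈ ℕ} for every x ∈ X. Then for every open set U ⊆ 𝔹 one has {x ∈ X : E(x) ∩ U ≠ ∅} ∈ Σ; in other words, E is a separable Banach 𝔹-bundle over X. -/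
open Set

/-- An open set meets the span of a family if and only if it contains a finite linear combination
whose coefficients belong to a fixed countable dense set of coefficient vectors. -/
theorem span_range_inter_nonempty_iff_denseSeq {ι E : Type*} [NormedAddCommGroup E]
    [NormedSpace ℝ E] (v : ι → E) {U : Set E} (hU : IsOpen U) :
    ((Submodule.span ℝ (range v) : Set E) ∩ U).Nonempty ↔
      ∃ (F : Finset ι) (n : ℕ),
        ∑ i, TopologicalSpace.denseSeq (F → ℝ) n i • v i ∈ U := by
  constructor
  · rintro ⟨y, hy, hyU⟩
    obtain ⟨c, rfl⟩ := Finsupp.mem_span_range_iff_exists_finsupp.1 hy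
    have hcont : Continuous fun a : c.support → ℝ => ∑ i, a i • v i := by fun_prop
    have hne : ((fun a : c.support → ℝ => ∑ i, a i • v i) ⁻¹' U).Nonempty := by
      refine ⟨fun i => c i, ?_⟩
      rw [Finsupp.sum, ← Finset.sum_coe_sort] at hyU
      exact hyU
    obtain ⟨a, ha, n, rfl⟩ :=
      (TopologicalSpace.denseRange_denseSeq (c.support → ℝ)).inter_open_nonempty _
        (hU.preimage hcont) hne
    exact ⟨c.support, n, ha⟩
  · rintro ⟨F, n, h⟩
    exact ⟨_, Submodule.sum_mem _ fun i _ =>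
      Submodule.smul_mem _ _ (Submodule.subset_span (mem_range_self _)), h⟩

/-- **Spans of measurable maps give separable Banach bundles.**
Let `(X, Σ)` be a measurable space and `𝔹` a separable Banach space. Given measurable maps
`sₙ : X → 𝔹`, define `E(x)` as the closure in `𝔹` of the linear span of `{sₙ(x) : n ∈ ℕ}`.
Then `{x : E(x) ∩ U ≠ ∅} ∈ Σ` for every open `U ⊆ 𝔹`, i.e. `E` is a separable Banach
`𝔹`-bundle over `X`. -/
theorem span_closure_is_banach_bundle
    {X 𝔹 : Type*} [MeasurableSpace X]
    [NormedAddCommGroup 𝔹] [NormedSpace ℝ 𝔹] [CompleteSpace 𝔹]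
    [TopologicalSpace.SeparableSpace 𝔹] [MeasurableSpace 𝔹] [BorelSpace 𝔹]
    (s : ℕ → X → 𝔹) (hs : ∀ n, Measurable (s n)) :
    ∀ U : Set 𝔹, IsOpen U →
      MeasurableSet
        {x | (closure (Submodule.span ℝ (Set.range fun n => s n x) : Set 𝔹) ∩ U).Nonempty} := by
  intro U hU
  have : SecondCountableTopology 𝔹 := UniformSpace.secondCountable_of_separable 𝔹
  simp only [closure_inter_open_nonempty_iff hU, span_range_inter_nonempty_iff_denseSeq _ hU,
    ofPred_exists]
  refine MeasurableSet.iUnion fun F => MeasurableSet.iUnion fun n => ?_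
  have hmeas : Measurable fun x =>
      ∑ i : F, TopologicalSpace.denseSeq (F → ℝ) n i • s i x :=
    Finset.measurable_fun_sum _ fun i _ => (hs i).const_smul _
  exact hmeas hU.measurableSet
end

section
/- Let (X,Σ) be a measurable space, 𝔹 a separable Banach space, and E a separable Banach 𝔹-bundle over X. Then there exists a countable ℚ-linear family 𝒞 of sections of E (i.e., 𝒞 is countable, closed under addition and multiplication by rationals, and each element is a measurable map s : X → 𝔹 with s(x) ∈ E(x) for all x) such that E(x) equals the closure in 𝔹 of {s(x) : s ∈ 𝒞} for every x ∈ X. -/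
open Set

/-- Refinement step of the Kuratowski–Ryll-Nardzewski construction: a measurable map which is
pointwise `ε`-close to a weakly measurable correspondence is `(ε + δ)`-close to a measurable map
which is `δ`-close to the correspondence. -/
theorem exists_measurable_refinement {X M : Type*} [MeasurableSpace X] [PseudoMetricSpace M]
    [TopologicalSpace.SeparableSpace M] [MeasurableSpace M] [BorelSpace M] {F : X → Set M}
    (hF : ∀ U : Set M, IsOpen U → MeasurableSet {x | (F x ∩ U).Nonempty})
    {f : X → M} (hf : Measurable f) {ε δ : ℝ} (hδ : 0 < δ)
    (hfF : ∀ x, (F x ∩ Metric.ball (f x) ε).Nonempty) :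
    ∃ g : X → M, Measurable g ∧ (∀ x, (F x ∩ Metric.ball (g x) δ).Nonempty) ∧
      ∀ x, dist (f x) (g x) ≤ ε + δ := by
  classical
  rcases isEmpty_or_nonempty X with hX | ⟨⟨x₀⟩⟩
  · exact ⟨f, hf, fun x => hX.elim x, fun x => hX.elim x⟩
  have : Nonempty M := ⟨f x₀⟩
  let d := TopologicalSpace.denseSeq M
  let p : X → ℕ → Prop := fun x n =>
    (F x ∩ Metric.ball (d n) δ).Nonempty ∧ dist (f x) (d n) < ε + δ
  have hp : ∀ x, ∃ n, p x n := fun x => by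
    obtain ⟨y, hyF, hy⟩ := hfF x
    obtain ⟨n, hn⟩ := (TopologicalSpace.denseRange_denseSeq M).exists_dist_lt y hδ
    refine ⟨n, ⟨y, hyF, hn⟩, ?_⟩
    rw [Metric.mem_ball, dist_comm] at hy
    exact (dist_triangle _ y _).trans_lt (add_lt_add hy hn)
  have hpm : ∀ n, MeasurableSet {x | p x n} := fun n =>
    (hF _ Metric.isOpen_ball).inter
      (measurableSet_lt ((measurable_id.dist measurable_const).comp hf) measurable_const)
  exact ⟨fun x => d (Nat.find (hp x)), measurable_from_nat.comp (measurable_find hp hpm),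
    fun x => (Nat.find_spec (hp x)).1, fun x => (Nat.find_spec (hp x)).2.le⟩

/-- A quantitative Kuratowski–Ryll-Nardzewski selection theorem. -/
theorem exists_measurable_selection_dist_le {X M : Type*} [MeasurableSpace X] [MetricSpace M]
    [CompleteSpace M] [TopologicalSpace.SeparableSpace M] [MeasurableSpace M] [BorelSpace M]
    {F : X → Set M} (hFclosed : ∀ x, IsClosed (F x))
    (hF : ∀ U : Set M, IsOpen U → MeasurableSet {x | (F x ∩ U).Nonempty})
    {f : X → M} (hf : Measurable f) {ε : ℝ} (hε : 0 < ε)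
    (hfF : ∀ x, (F x ∩ Metric.ball (f x) ε).Nonempty) :
    ∃ s : X → M, Measurable s ∧ (∀ x, s x ∈ F x) ∧ ∀ x, dist (f x) (s x) ≤ 3 * ε := by
  let A : ℕ → Type _ := fun n =>
    {g : X → M // Measurable g ∧ ∀ x, (F x ∩ Metric.ball (g x) (ε / 2 ^ n)).Nonempty}
  have step : ∀ n (g : A n), ∃ h : A (n + 1),
      ∀ x, dist (g.1 x) (h.1 x) ≤ ε / 2 ^ n + ε / 2 ^ (n + 1) := fun n g => by
    obtain ⟨h, hm, hF', hd⟩ := exists_measurable_refinement hF g.2.1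
      (show 0 < ε / 2 ^ (n + 1) by positivity) g.2.2
    exact ⟨⟨h, hm, hF'⟩, hd⟩
  choose next hnext using step
  let u : ∀ n, A n := fun n => Nat.rec ⟨f, hf, by simpa using hfF⟩ next n
  have hdist : ∀ x n, dist ((u n).1 x) ((u (n + 1)).1 x) ≤ 3 * ε / 2 / 2 ^ n := fun x n => by
    refine (hnext n (u n) x).trans_eq ?_
    rw [pow_succ]
    field_simp
    norm_num
  choose s hs using fun x =>
    cauchySeq_tendsto_of_complete (cauchySeq_of_le_geometric_two (hdist x))
  refine ⟨s, measurable_of_tendsto_metrizable (fun n => (u n).2.1) (tendsto_pi_nhds.2 hs),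
    fun x => ?_, fun x => dist_le_of_le_geometric_two_of_tendsto₀ (hdist x) (hs x)⟩
  choose y hyF hy using fun n => (u n).2.2 x
  have hlim : Filter.Tendsto (fun n => ε / 2 ^ n : ℕ → ℝ) Filter.atTop (nhds 0) := by
    simpa [div_eq_mul_inv] using (tendsto_pow_atTop_nhds_zero_of_lt_one
      (r := (2 : ℝ)⁻¹) (by norm_num) (by norm_num)).const_mul ε
  refine (hFclosed x).mem_of_tendsto ((tendsto_iff_of_dist ?_).1 (hs x))
    (Filter.Eventually.of_forall hyF)
  exact squeeze_zero (fun _ => dist_nonneg)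
    (fun n => by rw [dist_comm]; exact (Metric.mem_ball.1 (hy n)).le) hlim

/-- A Castaing representation: a weakly measurable correspondence with closed values admitting a
measurable selection has countably many measurable selections with pointwise dense values. -/
theorem exists_seq_measurable_selection_dense {X M : Type*} [MeasurableSpace X] [MetricSpace M]
    [CompleteSpace M] [TopologicalSpace.SeparableSpace M] [MeasurableSpace M] [BorelSpace M]
    {F : X → Set M} (hFclosed : ∀ x, IsClosed (F x))
    (hF : ∀ U : Set M, IsOpen U → MeasurableSet {x | (F x ∩ U).Nonempty})
    {f₀ : X → M} (hf₀ : Measurable f₀) (hf₀F : ∀ x, f₀ x ∈ F x) :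
    ∃ s : ℕ × ℕ → X → M, (∀ i, Measurable (s i)) ∧ (∀ i x, s i x ∈ F x) ∧
      ∀ x, F x ⊆ closure (range fun i => s i x) := by
  classical
  rcases isEmpty_or_nonempty X with hX | ⟨⟨x₀⟩⟩
  · exact ⟨fun _ => f₀, fun _ => hf₀, fun _ => hf₀F, fun x => hX.elim x⟩
  have : Nonempty M := ⟨f₀ x₀⟩
  let d := TopologicalSpace.denseSeq M
  let r : ℕ → ℝ := fun k => 1 / (k + 1)
  have hr : ∀ k, 0 < r k := fun k => Nat.one_div_pos_of_nat
  let V : ℕ × ℕ → Set X := fun i => {x | (F x ∩ Metric.ball (d i.1) (r i.2)).Nonempty}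
  let f : ℕ × ℕ → X → M := fun i => (V i).piecewise (fun _ => d i.1) f₀
  have hf : ∀ i, Measurable (f i) := fun i =>
    measurable_const.piecewise (hF _ Metric.isOpen_ball) hf₀
  have hfF : ∀ i x, (F x ∩ Metric.ball (f i x) (r i.2)).Nonempty := fun i x => by
    by_cases hx : x ∈ V i
    · simp only [f, piecewise_eq_of_mem _ _ _ hx]
      exact hx
    · simp only [f, piecewise_eq_of_notMem _ _ _ hx]
      exact ⟨f₀ x, hf₀F x, Metric.mem_ball_self (hr _)⟩
  choose s hsm hsF hsd using fun i =>
    exists_measurable_selection_dist_le hFclosed hF (hf i) (hr i.2) (hfF i)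
  refine ⟨s, hsm, hsF, fun x y hy => Metric.mem_closure_range_iff.2 fun δ hδ => ?_⟩
  obtain ⟨k, hk⟩ := exists_nat_one_div_lt (show 0 < δ / 4 by positivity)
  obtain ⟨n, hn⟩ := (TopologicalSpace.denseRange_denseSeq M).exists_dist_lt y (hr k)
  have hx : x ∈ V (n, k) := ⟨y, hy, hn⟩
  have hd := hsd (n, k) x
  simp only [f, piecewise_eq_of_mem _ _ _ hx] at hd
  refine ⟨(n, k), (dist_triangle y (d n) _).trans_lt ?_⟩
  change dist y (d n) < r k at hn
  change r k < δ / 4 at hk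
  linarith

/-- **Countable fiberwise-dense families of sections.**
Let `(X, Σ)` be a measurable space, `𝔹` a separable Banach space and `E` a separable Banach
`𝔹`-bundle over `X` (a map assigning to each `x` a closed linear subspace `E(x)` of `𝔹`,
weakly measurable as a correspondence). Then there exists a countable `ℚ`-linear family `𝒞`
of sections of `E` such that `E(x)` is the closure of `{s(x) : s ∈ 𝒞}` for every `x ∈ X`. -/
theorem exists_countable_dense_sections
    {X 𝔹 : Type*} [MeasurableSpace X]
    [NormedAddCommGroup 𝔹] [NormedSpace ℝ 𝔹] [CompleteSpace 𝔹]
    [TopologicalSpace.SeparableSpace 𝔹] [MeasurableSpace 𝔹] [BorelSpace 𝔹]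
    (E : X → Submodule ℝ 𝔹) (hEclosed : ∀ x, IsClosed (E x : Set 𝔹))
    (hEmeas : ∀ U : Set 𝔹, IsOpen U → MeasurableSet {x | ((E x : Set 𝔹) ∩ U).Nonempty}) :
    ∃ 𝒞 : Set (X → 𝔹), 𝒞.Countable ∧
      (∀ s ∈ 𝒞, Measurable s ∧ ∀ x, s x ∈ E x) ∧
      (∀ s ∈ 𝒞, ∀ t ∈ 𝒞, s + t ∈ 𝒞) ∧
      (∀ q : ℚ, ∀ s ∈ 𝒞, (q : ℝ) • s ∈ 𝒞) ∧
      (∀ x, (E x : Set 𝔹) = closure ((fun s : X → 𝔹 => s x) '' 𝒞)) := by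
  obtain ⟨s, hsm, hsE, hsd⟩ := exists_seq_measurable_selection_dense (F := fun x => (E x : Set 𝔹))
    hEclosed hEmeas (f₀ := fun _ => 0) measurable_const fun x => (E x).zero_mem
  have : SecondCountableTopology 𝔹 := UniformSpace.secondCountable_of_separable 𝔹
  let L : (ℕ × ℕ →₀ ℚ) → X → 𝔹 := fun c => c.sum fun i q => (q : ℝ) • s i
  have hLmem : ∀ c x, L c x ∈ E x := fun c x => by
    simp only [L, Finsupp.sum, Finset.sum_apply, Pi.smul_apply]
    exact Submodule.sum_mem _ fun i _ => (E x).smul_mem _ (hsE i x)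
  refine ⟨range L, countable_range L, ?_, ?_, ?_, fun x => subset_antisymm ?_ ?_⟩
  · rintro _ ⟨c, rfl⟩
    refine ⟨?_, hLmem c⟩
    simp only [L, Finsupp.sum, Finset.sum_fn]
    exact Finset.measurable_sum _ fun i _ => (hsm i).const_smul (c i : ℝ)
  · rintro _ ⟨c, rfl⟩ _ ⟨c', rfl⟩
    exact ⟨c + c', Finsupp.sum_add_index' (by simp) fun i q q' => by
      rw [Rat.cast_add, add_smul]⟩
  · rintro q _ ⟨c, rfl⟩
    refine ⟨q • c, ?_⟩
    simp only [L]
    rw [Finsupp.sum_smul_index (by simp), Finsupp.smul_sum]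
    simp only [Rat.cast_mul, mul_smul]
  · refine (hsd x).trans (closure_mono ?_)
    rintro _ ⟨i, rfl⟩
    exact ⟨s i, ⟨Finsupp.single i 1, by simp [L]⟩, rfl⟩
  · refine closure_minimal ?_ (hEclosed x)
    rintro _ ⟨_, ⟨c, rfl⟩, rfl⟩
    exact hLmem c x
end

section
/- Let (X,Σ) be a measurable space and let Δ = {0,2}^ℕ be the Cantor set with the metric d_Δ(a,b) = Σ_{n≥1} |a_n − b_n| / 3^n. Let K : X ⇉ Δ be a measurable correspondence with non-empty compact values. Then: (i) for every x ∈ X and a ∈ Δ there is a unique point r_x(a) ∈ K(x) with d_Δ(a, r_x(a)) = d_Δ(a, K(x)); (ii) for every a ∈ Δ, the map X ∋ x ↦ r_x(a) ∈ Δ is measurable. -/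
open Set

/-- The value in `ℝ` of a digit of the Cantor set `Δ = {0,2}^ℕ`, modelled as `ℕ → Bool`. -/
noncomputable def cantorVal (b : Bool) : ℝ := if b then 2 else 0

/-- The distance `d_Δ(a,b) = ∑_{n ≥ 1} |aₙ - bₙ| / 3ⁿ` on the Cantor set `Δ = {0,2}^ℕ`
(indexed here by `n : ℕ` starting from `0`, whence the exponent `n + 1`). -/
noncomputable def cantorDist (a b : ℕ → Bool) : ℝ :=
  ∑' n : ℕ, |cantorVal (a n) - cantorVal (b n)| / 3 ^ (n + 1)

/-- The Cantor distance is a rescaled Cantor function of the sequence of disagreements. -/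
lemma cantorDist_eq_cantorFunction (a b : ℕ → Bool) :
    cantorDist a b = 2 / 3 * Cardinal.cantorFunction (1 / 3) (fun n => xor (a n) (b n)) := by
  rw [cantorDist, Cardinal.cantorFunction, ← tsum_mul_left]
  refine tsum_congr fun n => ?_
  cases ha : a n <;> cases hb : b n <;>
    simp [cantorVal, Cardinal.cantorFunctionAux, ha, hb, pow_succ] <;> field_simp

lemma cantorDist_injective (a : ℕ → Bool) : Function.Injective (cantorDist a) := by
  intro b c h
  rw [cantorDist_eq_cantorFunction, cantorDist_eq_cantorFunction] at h
  have h' := Cardinal.cantorFunction_injective (c := 1 / 3) (by norm_num) (by norm_num)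
    (mul_left_cancel₀ (by norm_num) h)
  funext n
  exact Bool.xor_right_inj.mp (congrFun h' n)

lemma continuous_cantorDist (a : ℕ → Bool) : Continuous (cantorDist a) := by
  have hdigit : Continuous cantorVal := continuous_of_discreteTopology
  have hsum : Summable fun n : ℕ => 2 / 3 * (1 / 3 : ℝ) ^ n :=
    (summable_geometric_of_lt_one (by norm_num) (by norm_num)).mul_left _
  refine continuous_tsum (fun n => by fun_prop) hsum fun n b => ?_
  rw [Real.norm_of_nonneg (by positivity)]
  cases a n <;> cases b n <;> simp [cantorVal, pow_succ] <;> field_simp <;> norm_num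

lemma isClosedEmbedding_cantorDist (a : ℕ → Bool) :
    Topology.IsClosedEmbedding (cantorDist a) :=
  (continuous_cantorDist a).isClosedEmbedding (cantorDist_injective a)

/-- **Measurable retractions onto the values of a measurable correspondence into the Cantor
set.** Let `(X, Σ)` be a measurable space and `Δ = {0,2}^ℕ` the Cantor set with the metric
`d_Δ(a,b) = ∑ₙ |aₙ - bₙ|/3ⁿ`. Let `K : X ⇉ Δ` be a measurable correspondence with non-empty
compact values. Then:
(i) for every `x ∈ X` and `a ∈ Δ`, there is a unique `r_x(a) ∈ K(x)` with
    `d_Δ(a, r_x(a)) = d_Δ(a, K(x))`;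
(ii) for every `a ∈ Δ`, the map `x ↦ r_x(a)` is measurable. -/
theorem cantor_retraction_measurable
    {X : Type*} [MeasurableSpace X] (K : X → Set (ℕ → Bool))
    (hne : ∀ x, (K x).Nonempty) (hcp : ∀ x, IsCompact (K x))
    (hmeas : ∀ C : Set (ℕ → Bool), IsClosed C → MeasurableSet {x | (K x ∩ C).Nonempty}) :
    (∀ x, ∀ a : ℕ → Bool,
      ∃! b, b ∈ K x ∧ cantorDist a b = sInf (cantorDist a '' K x)) ∧
    (∀ a : ℕ → Bool, ∃ r : X → ℕ → Bool, Measurable r ∧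
      ∀ x, r x ∈ K x ∧ cantorDist a (r x) = sInf (cantorDist a '' K x)) := by
  have hmin : ∀ x, ∀ a : ℕ → Bool,
      ∃ b, b ∈ K x ∧ cantorDist a b = sInf (cantorDist a '' K x) := fun x a => by
    obtain ⟨b, hb, h⟩ :=
      (hcp x).exists_sInf_image_eq (hne x) (continuous_cantorDist a).continuousOn
    exact ⟨b, hb, h.symm⟩
  refine ⟨fun x a => ?_, fun a => ?_⟩
  · obtain ⟨b, hb, h⟩ := hmin x a
    exact ⟨b, ⟨hb, h⟩, fun c hc => cantorDist_injective a (hc.2.trans h.symm)⟩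
  · choose r hr using fun x => hmin x a
    refine ⟨r, ?_, hr⟩
    rw [← (isClosedEmbedding_cantorDist a).measurableEmbedding.measurable_comp_iff]
    refine measurable_of_Iic fun t => ?_
    convert hmeas _ (isClosed_Iic.preimage (continuous_cantorDist a) : IsClosed
      (cantorDist a ⁻¹' Iic t)) using 1
    ext x
    refine ⟨fun h => ⟨r x, (hr x).1, h⟩, fun ⟨b, hb, hbt⟩ => ?_⟩
    have hle : cantorDist a (r x) ≤ cantorDist a b := by
      rw [(hr x).2]
      exact csInf_le ((hcp x).image (continuous_cantorDist a)).bddBelow (mem_image_of_mem _ hb)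
    exact hle.trans hbt
end

section
/- Let (X,Σ) be a measurable space and 𝔹 a universal separable Banach space. Let {E(x)}_{x∈X} be a measurable collection of separable Banach spaces, with distinguished elements v_n(x) ∈ E(x) as in the definition. Then there exists a family {I_x}_{x∈X} of linear isometric embeddings I_x : E(x) → 𝔹 such that for every n ∈ ℕ the map X ∋ x ↦ I_x[v_n(x)] ∈ 𝔹 is measurable. -/
open Set

universe u

open scoped RealInnerProductSpace

/-- A map into a second countable metric space is measurable if its distance to every point is. -/
theorem measurable_of_measurable_dist {X α : Type*} [MeasurableSpace X] [PseudoMetricSpace α]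
    [SecondCountableTopology α] [MeasurableSpace α] [BorelSpace α] {f : X → α}
    (hf : ∀ y, Measurable fun x => dist (f x) y) : Measurable f := by
  have hb : TopologicalSpace.IsTopologicalBasis {s : Set α | ∃ y r, s = Metric.ball y r} := by
    refine TopologicalSpace.isTopologicalBasis_of_isOpen_of_nhds ?_ ?_
    · rintro _ ⟨y, r, rfl⟩
      exact Metric.isOpen_ball
    · intro y u hy hu
      obtain ⟨r, hr, hru⟩ := Metric.isOpen_iff.1 hu y hy
      exact ⟨_, ⟨y, r, rfl⟩, Metric.mem_ball_self hr, hru⟩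
  rw [BorelSpace.measurable_eq (α := α), hb.borel_eq_generateFrom]
  refine measurable_generateFrom ?_
  rintro _ ⟨y, r, rfl⟩
  exact measurableSet_lt (hf y) measurable_const

/-- A `C(K, ℝ)`-valued map, with `K` compact and second countable, is measurable if all its
evaluations at points of `K` are. -/
theorem ContinuousMap.measurable_of_measurable_eval {X K : Type*} [MeasurableSpace X]
    [TopologicalSpace K] [CompactSpace K] [LocallyCompactSpace K] [SecondCountableTopology K]
    [MeasurableSpace C(K, ℝ)] [BorelSpace C(K, ℝ)] {f : X → C(K, ℝ)}
    (hf : ∀ t, Measurable fun x => f x t) : Measurable f := by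
  refine measurable_of_measurable_dist fun g => measurable_of_Iic fun r => ?_
  obtain ⟨D, hD, hDd⟩ := TopologicalSpace.exists_countable_dense K
  rcases lt_or_ge r 0 with hr | hr
  · convert MeasurableSet.empty
    ext x
    simpa using hr.trans_le dist_nonneg
  · have : (fun x => dist (f x) g) ⁻¹' Iic r = ⋂ t ∈ D, {x | dist (f x t) (g t) ≤ r} := by
      ext x
      simp only [mem_preimage, mem_Iic, mem_iInter, mem_ofPred_eq]
      rw [ContinuousMap.dist_le hr]
      refine ⟨fun h t _ => h t, fun h t => ?_⟩
      have hc : IsClosed {t | dist (f x t) (g t) ≤ r} :=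
        isClosed_le (by fun_prop) continuous_const
      exact hc.closure_subset_iff.2 h (hDd t)
    rw [this]
    exact MeasurableSet.biInter hD fun t _ =>
      measurableSet_le ((hf t).dist measurable_const) measurable_const

/-- There is a countable set of finite convex weights that is enough to describe, up to closure,
the convex hull of any sequence. -/
theorem exists_countable_dense_convexHull_range (E : Type*) [NormedAddCommGroup E]
    [NormedSpace ℝ E] :
    ∃ D : Set (Finset ℕ × (ℕ → ℝ)), D.Countable ∧ ∀ c : ℕ → E,
      closure ((fun p => ∑ i ∈ p.1, p.2 i • c i) '' D) = closure (convexHull ℝ (range c)) := by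
  let W (s : Finset ℕ) : Set (ℕ → ℝ) := {w | (∀ i ∈ s, 0 ≤ w i) ∧ ∑ i ∈ s, w i = 1}
  have hW (s : Finset ℕ) : ∃ t ⊆ W s, t.Countable ∧ W s ⊆ closure t :=
    (TopologicalSpace.IsSeparable.of_separableSpace (W s)).exists_countable_dense_subset
  choose T hTW hT hWT using hW
  refine ⟨⋃ s, (Prod.mk s) '' T s, countable_iUnion fun s => (hT s).image _, fun c => ?_⟩
  refine (closure_mono ?_).antisymm (closure_minimal ?_ isClosed_closure)
  · rintro _ ⟨⟨s, w⟩, hw, rfl⟩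
    obtain ⟨s', w', hw', h⟩ := mem_iUnion.1 hw
    obtain ⟨rfl, rfl⟩ := Prod.mk.inj h
    exact (convex_convexHull ℝ _).sum_mem (hTW _ hw').1 (hTW _ hw').2
      fun i _ => subset_convexHull ℝ _ (mem_range_self i)
  · rw [convexHull_range_eq_exists_affineCombination]
    rintro _ ⟨s, w, hw0, hw1, rfl⟩
    rw [s.affineCombination_eq_linear_combination _ _ hw1]
    have hc : Continuous fun w : ℕ → ℝ => ∑ i ∈ s, w i • c i := by fun_prop
    refine map_mem_closure (f := fun w : ℕ → ℝ => ∑ i ∈ s, w i • c i) hc (hWT s ⟨hw0, hw1⟩)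
      fun w hw => ?_
    exact ⟨(s, w), mem_iUnion.2 ⟨s, w, hw, rfl⟩, rfl⟩

/-- The metric projection onto a nonempty closed convex subset of a Hilbert space is `1`-Lipschitz,
and `y - P y` is half the gradient of the squared distance to the set. -/
theorem exists_metricProjection {H : Type*} [NormedAddCommGroup H] [InnerProductSpace ℝ H]
    [CompleteSpace H] {C : Set H} (hne : C.Nonempty) (hcl : IsClosed C) (hC : Convex ℝ C) :
    ∃ P : H → H, (∀ y, P y ∈ C) ∧ (∀ y ∈ C, P y = y) ∧ LipschitzWith 1 P ∧
      ∀ y h, |Metric.infDist (y + h) C ^ 2 - Metric.infDist y C ^ 2 - 2 * ⟪h, y - P y⟫|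
        ≤ ‖h‖ ^ 2 := by
  choose P hPC hP using exists_norm_eq_iInf_of_complete_convex hne hcl.isComplete hC
  have hin (y) : ∀ w ∈ C, ⟪y - P y, w - P y⟫ ≤ 0 :=
    (norm_eq_iInf_iff_real_inner_le_zero hC (hPC y)).1 (hP y)
  have hd (y) : Metric.infDist y C = ‖y - P y‖ := by
    simp only [hP y, Metric.infDist_eq_iInf, dist_eq_norm]
  have hle (y w) (hw : w ∈ C) : ‖y - P y‖ ≤ ‖y - w‖ := by
    rw [← hd, ← dist_eq_norm]
    exact Metric.infDist_le_dist_of_mem hw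
  have hlip (y z) : ‖P y - P z‖ ≤ ‖y - z‖ := by
    have h1 := hin y (P z) (hPC z)
    have h2 := hin z (P y) (hPC y)
    have h3 : ‖P y - P z‖ ^ 2 ≤ ⟪y - z, P y - P z⟫ := by
      rw [← real_inner_self_eq_norm_sq]
      simp only [inner_sub_left, inner_sub_right] at h1 h2 ⊢
      linarith
    have h4 := real_inner_le_norm (y - z) (P y - P z)
    by_contra! h
    nlinarith [norm_nonneg (y - z), norm_nonneg (P y - P z)]
  refine ⟨P, hPC, fun y hy => ?_, LipschitzWith.of_dist_le_mul fun y z => ?_, fun y h => ?_⟩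
  · have := hle y y hy
    rw [sub_self, norm_zero, norm_le_zero_iff, sub_eq_zero] at this
    exact this.symm
  · simpa [dist_eq_norm] using hlip y z
  · rw [hd, hd, abs_le]
    have h1 := pow_le_pow_left₀ (norm_nonneg _) (hle (y + h) (P y) (hPC y)) 2
    have h2 := pow_le_pow_left₀ (norm_nonneg _) (hle y (P (y + h)) (hPC (y + h))) 2
    rw [show y + h - P y = h + (y - P y) by abel, norm_add_sq_real] at h1
    rw [show y - P (y + h) = (y + h - P (y + h)) - h by abel,
      norm_sub_sq_real (y + h - P (y + h)) h] at h2
    have h3 := real_inner_le_norm h (P (y + h) - P y)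
    have h4 := hlip (y + h) y
    rw [add_sub_cancel_left] at h4
    have h5 : ‖h‖ * ‖P (y + h) - P y‖ ≤ ‖h‖ ^ 2 := by
      rw [sq]; gcongr
    have h6 : ⟪y + h - P (y + h), h⟫
        = ⟪h, y - P y⟫ + ‖h‖ ^ 2 - ⟪h, P (y + h) - P y⟫ := by
      rw [← real_inner_self_eq_norm_sq, real_inner_comm]
      simp only [inner_sub_right, inner_add_right]
      ring
    constructor <;> linarith

/-- If the distances to a family of sets depend measurably on the parameter, then so do their metric
projections, weakly: the projection is recovered from the gradient of the squared distance. -/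
theorem measurable_inner_of_infDist {X H : Type*} [MeasurableSpace X] [NormedAddCommGroup H]
    [InnerProductSpace ℝ H] {C : X → Set H} {P : X → H → H}
    (hP : ∀ x y h, |Metric.infDist (y + h) (C x) ^ 2 - Metric.infDist y (C x) ^ 2
      - 2 * ⟪h, y - P x y⟫| ≤ ‖h‖ ^ 2)
    (hC : ∀ y, Measurable fun x => Metric.infDist y (C x)) (e y : H) :
    Measurable fun x => ⟪e, P x y⟫ := by
  let ε (n : ℕ) : ℝ := 1 / ((n : ℝ) + 1)
  have hε (n) : 0 < ε n := by positivity
  suffices h : Measurable fun x => ⟪e, y - P x y⟫ by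
    simpa [inner_sub_right] using h.const_sub ⟪e, y⟫
  refine measurable_of_tendsto_metrizable (f := fun n x => (Metric.infDist (y + ε n • e) (C x) ^ 2
    - Metric.infDist y (C x) ^ 2) / (2 * ε n)) (fun n => ?_) (tendsto_pi_nhds.2 fun x => ?_)
  · exact (((hC _).pow_const 2).sub ((hC _).pow_const 2)).div_const _
  · rw [tendsto_iff_dist_tendsto_zero]
    have hlim : Filter.Tendsto (fun n => ε n * (‖e‖ ^ 2 / 2)) Filter.atTop (nhds 0) := by
      simpa [ε] using (tendsto_one_div_add_atTop_nhds_zero_nat (𝕜 := ℝ)).mul_const (‖e‖ ^ 2 / 2)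
    refine squeeze_zero (fun _ => dist_nonneg) (fun n => ?_) hlim
    have h := hP x y (ε n • e)
    rw [inner_smul_left, norm_smul, Real.norm_of_nonneg (hε n).le] at h
    rw [Real.dist_eq, ← mul_le_mul_iff_right₀ (show 0 < 2 * ε n by have := hε n; positivity)]
    calc _ = |2 * ε n * ((Metric.infDist (y + ε n • e) (C x) ^ 2
            - Metric.infDist y (C x) ^ 2) / (2 * ε n) - ⟪e, y - P x y⟫)| := by
          rw [abs_mul, abs_of_pos (show 0 < 2 * ε n by have := hε n; positivity)]
      _ ≤ (ε n * ‖e‖) ^ 2 := by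
          convert h using 2
          have := (hε n).ne'
          simp only [conj_trivial]
          field_simp
      _ = _ := by ring

/-- Sequences whose linear combinations have the same norms are related by a linear isometry,
provided the first one is dense. -/
theorem exists_linearIsometry_of_norm_linearCombination {E F : Type*} [NormedAddCommGroup E]
    [NormedSpace ℝ E] [NormedAddCommGroup F] [NormedSpace ℝ F] [CompleteSpace F]
    {v : ℕ → E} {f : ℕ → F} (hv : DenseRange v)
    (h : ∀ a : ℕ →₀ ℝ, ‖Finsupp.linearCombination ℝ f a‖ = ‖Finsupp.linearCombination ℝ v a‖) :
    ∃ I : E →ₗᵢ[ℝ] F, ∀ n, I (v n) = f n := by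
  have hd : DenseRange (Finsupp.linearCombination ℝ v) := by
    refine hv.mono ?_
    rintro _ ⟨n, rfl⟩
    exact ⟨Finsupp.single n 1, by simp⟩
  have hb : ∃ C, ∀ a, ‖Finsupp.linearCombination ℝ f a‖
      ≤ C * ‖Finsupp.linearCombination ℝ v a‖ := ⟨1, fun a => by simp [h]⟩
  let T := (Finsupp.linearCombination ℝ f).extendOfNorm (Finsupp.linearCombination ℝ v)
  have hT (a) : T (Finsupp.linearCombination ℝ v a) = Finsupp.linearCombination ℝ f a :=
    LinearMap.extendOfNorm_eq hd hb a
  refine ⟨⟨T.toLinearMap, fun z => ?_⟩, fun n => ?_⟩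
  · exact hd.induction (P := fun z => ‖T z‖ = ‖z‖) (by rintro _ ⟨a, rfl⟩; rw [hT, h])
      (isClosed_eq (by fun_prop) (by fun_prop)) z
  · simpa using hT (Finsupp.single n 1)

/-- Functions on `K` whose evaluations are dominated by the norm, and which realize a norming
sequence of functionals, have linear combinations of the same norm as the original vectors. -/
theorem norm_linearCombination_eq_of_norming {E K : Type*} [NormedAddCommGroup E]
    [NormedSpace ℝ E] [TopologicalSpace K] [CompactSpace K] {v : ℕ → E} {φ : ℕ → E →L[ℝ] ℝ}
    (hv : DenseRange v) (hφ : ∀ n, ‖φ n‖ ≤ 1) (hφv : ∀ n, φ n (v n) = ‖v n‖)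
    {f : ℕ → C(K, ℝ)} {τ : ℕ → K} (hτ : ∀ n k, f k (τ n) = φ n (v k))
    (hf : ∀ a t, ‖Finsupp.linearCombination ℝ (fun k => f k t) a‖
      ≤ ‖Finsupp.linearCombination ℝ v a‖) (a : ℕ →₀ ℝ) :
    ‖Finsupp.linearCombination ℝ f a‖ = ‖Finsupp.linearCombination ℝ v a‖ := by
  have heval (t) : Finsupp.linearCombination ℝ f a t
      = Finsupp.linearCombination ℝ (fun k => f k t) a := by
    simp [Finsupp.linearCombination_apply, Finsupp.sum, ContinuousMap.sum_apply]
  refine le_antisymm ((ContinuousMap.norm_le _ (norm_nonneg _)).2 fun t => ?_) ?_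
  · rw [heval]
    exact hf a t
  · set z := Finsupp.linearCombination ℝ v a with hz
    have hn (n) : φ n z ≤ ‖Finsupp.linearCombination ℝ f a‖ := by
      refine le_trans (le_of_eq ?_) ((le_abs_self _).trans
        ((Finsupp.linearCombination ℝ f a).norm_coe_le_norm (τ n)))
      rw [heval, hz]
      simp [Finsupp.linearCombination_apply, Finsupp.sum, hτ]
    have hcl : IsClosed {y : E | ‖z‖ ≤ ‖Finsupp.linearCombination ℝ f a‖ + 2 * ‖z - y‖} :=
      isClosed_le (by fun_prop) (by fun_prop)
    have := hv.induction (P := fun y => ‖z‖ ≤ ‖Finsupp.linearCombination ℝ f a‖ + 2 * ‖z - y‖)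
      (by
        rintro _ ⟨n, rfl⟩
        have h1 : φ n (v n) - φ n z ≤ ‖z - v n‖ := by
          rw [← map_sub, norm_sub_rev]
          exact (le_abs_self _).trans ((φ n).le_of_opNorm_le (hφ n) _ |>.trans_eq (one_mul _))
        have h2 := norm_sub_norm_le z (v n)
        linarith [hn n, hφv n]) hcl z
    simpa using this

/-- The Hilbert cube maps continuously to `ℓ²` so that the coordinates are recovered by
inner products. -/
theorem exists_continuous_cube_to_l2 :
    ∃ (Ψ : (ULift.{u} ℕ → Icc (-1 : ℝ) 1) → lp (fun _ : ℕ => ℝ) 2)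
      (e : ℕ → lp (fun _ : ℕ => ℝ) 2),
      Continuous Ψ ∧ ∀ n t, ⟪e n, Ψ t⟫ = t ⟨n⟩ := by
  let b (k : ℕ) : lp (fun _ : ℕ => ℝ) 2 := lp.single 2 k 1
  have hb (k) : ‖b k‖ = 1 := by simp [b, lp.norm_single]
  have hle (k : ℕ) (t : ULift.{u} ℕ → Icc (-1 : ℝ) 1) :
      ‖((1 / 2 : ℝ) ^ k * t ⟨k⟩) • b k‖ ≤ (1 / 2) ^ k := by
    rw [norm_smul, hb, mul_one, norm_mul, Real.norm_of_nonneg (by positivity)]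
    exact mul_le_of_le_one_right (by positivity) (abs_le.2 (t ⟨k⟩).2)
  refine ⟨fun t => ∑' k : ℕ, ((1 / 2 : ℝ) ^ k * t ⟨k⟩) • b k, fun n => (2 : ℝ) ^ n • b n,
    continuous_tsum (fun k => by fun_prop) summable_geometric_two hle, fun n t => ?_⟩
  have hs := Summable.of_norm_bounded summable_geometric_two fun k => hle k t
  have hbb (k) : ⟪b n, b k⟫ = if k = n then (1 : ℝ) else 0 := by
    simp only [b, lp.inner_single_left]
    by_cases h : k = n
    · subst h; simp
    · simp [lp.single_apply, h, Ne.symm h]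
  rw [inner_smul_left, ← innerSL_apply_apply ℝ, ContinuousLinearMap.map_tsum _ hs,
    tsum_eq_single n]
  · simp only [map_smul, innerSL_apply_apply, hbb, if_true, smul_eq_mul, mul_one, conj_trivial]
    rw [← mul_assoc, ← mul_pow]
    norm_num
  · intro k hk
    simp [hbb, hk]

/-- **Measurable family of embeddings.**
Let `(X, Σ)` be a measurable space and `𝔹` a universal separable Banach space. Let
`{E(x)}_{x ∈ X}` be a measurable collection of separable Banach spaces, witnessed by dense
sequences `vₙ(x) ∈ E(x)` and norming functionals `ωₙ(x) ∈ E(x)'` with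
`x ↦ ωₙ(x)[v_k(x)]` measurable. Then there exists a family `{I_x}` of linear isometric
embeddings `I_x : E(x) → 𝔹` such that `x ↦ I_x[vₙ(x)]` is measurable for every `n`. -/
theorem measurable_family_of_embeddings
    {X : Type*} [MeasurableSpace X]
    {𝔹 : Type*} [NormedAddCommGroup 𝔹] [NormedSpace ℝ 𝔹] [CompleteSpace 𝔹]
    [TopologicalSpace.SeparableSpace 𝔹] [MeasurableSpace 𝔹] [BorelSpace 𝔹]
    (hUniv : ∀ (F : Type u) [NormedAddCommGroup F] [NormedSpace ℝ F] [CompleteSpace F]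
      [TopologicalSpace.SeparableSpace F], Nonempty (F →ₗᵢ[ℝ] 𝔹))
    (E : X → Type u) [∀ x, NormedAddCommGroup (E x)] [∀ x, NormedSpace ℝ (E x)]
    [∀ x, CompleteSpace (E x)]
    (v : ℕ → ∀ x, E x) (ω : ℕ → ∀ x, E x →L[ℝ] ℝ)
    (hdense : ∀ x, DenseRange fun n => v n x)
    (hnorming : ∀ n x, v n x ≠ 0 → ‖ω n x‖ = 1 ∧ ω n x (v n x) = ‖v n x‖)
    (hmeas : ∀ n k, Measurable fun x => ω n x (v k x)) :
    ∃ I : ∀ x, E x →ₗᵢ[ℝ] 𝔹, ∀ n, Measurable fun x => I x (v n x) := by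
  classical
  have hvω (n x) : ω n x (v n x) = ‖v n x‖ := by
    by_cases h : v n x = 0
    · simp [h]
    · exact (hnorming n x h).2
  have hvm (n) : Measurable fun x => ‖v n x‖ := by simpa only [hvω] using hmeas n n
  let φ (n : ℕ) (x : X) : E x →L[ℝ] ℝ := if ‖v n x‖ = 0 then 0 else ω n x
  have hφ0 {n x} (h : ‖v n x‖ = 0) : φ n x = 0 := if_pos h
  have hφ1 {n x} (h : ‖v n x‖ ≠ 0) : φ n x = ω n x := if_neg h
  have hφ (n x) : ‖φ n x‖ ≤ 1 := by
    by_cases h : ‖v n x‖ = 0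
    · simp [hφ0 h]
    · exact hφ1 h ▸ (hnorming n x (norm_ne_zero_iff.1 h)).1.le
  have hφv (n x) : φ n x (v n x) = ‖v n x‖ := by
    by_cases h : ‖v n x‖ = 0
    · rw [hφ0 h, h, zero_apply]
    · rw [hφ1 h, hvω]
  have hφm (n k) : Measurable fun x => φ n x (v k x) := by
    have h : (fun x => φ n x (v k x)) = fun x => if ‖v n x‖ = 0 then 0 else ω n x (v k x) := by
      ext x
      by_cases h : ‖v n x‖ = 0
      · rw [hφ0 h, if_pos h, zero_apply]
      · rw [hφ1 h, if_neg h]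
    rw [h]
    exact Measurable.ite (hvm n (measurableSet_singleton 0)) measurable_const (hmeas n k)
  let K := ULift.{u} ℕ → Icc (-1 : ℝ) 1
  have hρ (k x) : 0 < 1 + ‖v k x‖ := by positivity
  have hmem (n k x) : φ n x (v k x) / (1 + ‖v k x‖) ∈ Icc (-1 : ℝ) 1 := by
    rw [mem_Icc, ← abs_le, abs_div, abs_of_pos (hρ k x), div_le_one (hρ k x)]
    have := (φ n x).le_of_opNorm_le (hφ n x) (v k x)
    rw [Real.norm_eq_abs] at this
    linarith
  let τ (n : ℕ) (x : X) : K := fun k => ⟨_, hmem n k.down x⟩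
  have hτm (n) : Measurable (τ n) :=
    measurable_pi_lambda _ fun k => ((hφm n _).div ((hvm _).const_add 1)).subtype_mk
  obtain ⟨Ψ, e, hΨ, he⟩ := exists_continuous_cube_to_l2.{u}
  let C (x : X) := closure (convexHull ℝ (range fun n => Ψ (τ n x)))
  have hτC (n x) : Ψ (τ n x) ∈ C x :=
    subset_closure (subset_convexHull ℝ _ (mem_range_self n))
  have hCm (y) : Measurable fun x => Metric.infDist y (C x) := by
    obtain ⟨D, hD, hDC⟩ := exists_countable_dense_convexHull_range (lp (fun _ : ℕ => ℝ) 2)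
    have := hD.to_subtype
    simp only [C, ← hDC, Metric.infDist_closure, image_eq_range]
    simp only [Metric.infDist_eq_iInf, iInf_range']
    refine Measurable.iInf fun p => ?_
    have hc : Continuous fun s : ℕ → K => dist y (∑ i ∈ p.1.1, p.1.2 i • Ψ (s i)) := by
      fun_prop
    exact hc.measurable.comp (measurable_pi_lambda _ hτm)
  choose P hPC hPid hPl hPd using fun x => exists_metricProjection ⟨_, hτC 0 x⟩
    (isClosed_closure : IsClosed (C x)) (convex_convexHull ℝ _).closure
  let f (k : ℕ) (x : X) : C(K, ℝ) :=
    ⟨fun t => (1 + ‖v k x‖) * ⟪e k, P x (Ψ t)⟫, by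
      have := (hPl x).continuous
      fun_prop⟩
  have hcoord (n k x) : (1 + ‖v k x‖) * ⟪e k, Ψ (τ n x)⟫ = φ n x (v k x) := by
    rw [he]
    exact mul_div_cancel₀ _ (hρ k x).ne'
  have hbound (x) (a : ℕ →₀ ℝ) : ∀ c ∈ C x,
      ‖Finsupp.linearCombination ℝ (fun k => (1 + ‖v k x‖) * ⟪e k, c⟫) a‖
        ≤ ‖Finsupp.linearCombination ℝ (fun k => v k x) a‖ := by
    let g : lp (fun _ : ℕ => ℝ) 2 := ∑ k ∈ a.support, (a k * (1 + ‖v k x‖)) • e k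
    have hg (c) : Finsupp.linearCombination ℝ (fun k => (1 + ‖v k x‖) * ⟪e k, c⟫) a
        = innerSL ℝ g c := by
      simp [g, Finsupp.linearCombination_apply, Finsupp.sum, mul_assoc]
    set r := ‖Finsupp.linearCombination ℝ (fun k => v k x) a‖ with hr
    have hsub : C x ⊆ innerSL ℝ g ⁻¹' Metric.closedBall 0 r := by
      refine closure_minimal (convexHull_min ?_ ?_) ?_
      · rintro _ ⟨n, rfl⟩
        rw [mem_preimage, mem_closedBall_zero_iff, ← hg]
        simp only [hcoord]
        refine le_trans (le_of_eq ?_)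
          ((φ n x).le_of_opNorm_le (hφ n x) (Finsupp.linearCombination ℝ (fun k => v k x) a)
            |>.trans_eq (one_mul _))
        simp [Finsupp.linearCombination_apply, Finsupp.sum]
      · exact (convex_closedBall 0 r).linear_preimage (innerSL ℝ g).toLinearMap
      · exact Metric.isClosed_closedBall.preimage (innerSL ℝ g).continuous
    intro c hc
    rw [hg]
    exact mem_closedBall_zero_iff.1 (hsub hc)
  choose I hI using fun x => exists_linearIsometry_of_norm_linearCombination (hdense x)
    (norm_linearCombination_eq_of_norming (f := fun k => f k x) (τ := fun n => τ n x)
      (hdense x) (hφ · x) (hφv · x)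
      (fun n k => by simp [f, hPid x _ (hτC n x), hcoord])
      (fun a t => hbound x a _ (hPC x _)))
  obtain ⟨J⟩ := hUniv C(K, ℝ)
  refine ⟨fun x => J.comp (I x), fun n => ?_⟩
  borelize C(K, ℝ)
  have hf : Measurable (f n) := ContinuousMap.measurable_of_measurable_eval fun t =>
    ((hvm n).const_add 1).mul (measurable_inner_of_infDist hPd hCm (e n) (Ψ t))
  convert J.continuous.measurable.comp hf using 2 with x
  exact congrArg J (hI x n)
end

section
/- Let (X,Σ) be a measurable space and 𝔹 a universal separable Banach space. Let {E(x)}_{x∈X} be a measurable collection of separable Banach spaces, and let {I_x}_{x∈X} be an associated measurable family of linear isometric embeddings I_x : E(x) → 𝔹 (i.e., x ↦ I_x[v_n(x)] is measurable for every n). Then the map X ∋ x ↦ E(x)' := I_x(E(x)) is a separable Banach 𝔹-bundle over X: each I_x(E(x)) is a closed linear subspace of 𝔹 and {x ∈ X : I_x(E(x)) ∩ U ≠ ∅} ∈ Σ for every open U ⊆ 𝔹. -/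
open Set

universe u

/-- The map sending `x` to the closure of `{s n x : n ∈ ℕ}` is weakly measurable, for every
sequence of measurable maps `s n`. -/
theorem measurableSet_nonempty_inter_of_closure_range {X Y : Type*} [MeasurableSpace X]
    [TopologicalSpace Y] [MeasurableSpace Y] [OpensMeasurableSpace Y] {s : ℕ → X → Y}
    (hs : ∀ n, Measurable (s n)) {F : X → Set Y} (hF : ∀ x, F x = closure (range fun n => s n x))
    {U : Set Y} (hU : IsOpen U) : MeasurableSet {x | (F x ∩ U).Nonempty} := by
  have h : {x | (F x ∩ U).Nonempty} = ⋃ n, s n ⁻¹' U := by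
    ext x
    simp only [mem_ofPred_eq, hF, closure_inter_open_nonempty_iff hU, mem_iUnion, mem_preimage]
    simp [Set.Nonempty]
  rw [h]
  exact MeasurableSet.iUnion fun n => hs n hU.measurableSet

/-- **The image of a measurable family of embeddings is a separable Banach bundle.**
Let `(X, Σ)` be a measurable space and `𝔹` a universal separable Banach space. Let
`{E(x)}_{x ∈ X}` be a measurable collection of separable Banach spaces (with data
`vₙ(x)`, `ωₙ(x)` as in the definition) and let `{I_x}` be an associated measurable family
of linear isometric embeddings `I_x : E(x) → 𝔹` (i.e. `x ↦ I_x[vₙ(x)]` is measurable for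
every `n`). Then `x ↦ I_x(E(x))` is a separable Banach `𝔹`-bundle over `X`: each
`I_x(E(x))` is a closed linear subspace of `𝔹`, and `{x : I_x(E(x)) ∩ U ≠ ∅} ∈ Σ` for
every open `U ⊆ 𝔹`. -/
theorem image_of_measurable_embeddings_is_bundle
    {X : Type*} [MeasurableSpace X]
    {𝔹 : Type*} [NormedAddCommGroup 𝔹] [NormedSpace ℝ 𝔹] [CompleteSpace 𝔹]
    [TopologicalSpace.SeparableSpace 𝔹] [MeasurableSpace 𝔹] [BorelSpace 𝔹]
    (hUniv : ∀ (F : Type u) [NormedAddCommGroup F] [NormedSpace ℝ F] [CompleteSpace F]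
      [TopologicalSpace.SeparableSpace F], Nonempty (F →ₗᵢ[ℝ] 𝔹))
    (E : X → Type u) [∀ x, NormedAddCommGroup (E x)] [∀ x, NormedSpace ℝ (E x)]
    [∀ x, CompleteSpace (E x)]
    (v : ℕ → ∀ x, E x) (ω : ℕ → ∀ x, E x →L[ℝ] ℝ)
    (hdense : ∀ x, DenseRange fun n => v n x)
    (hnorming : ∀ n x, v n x ≠ 0 → ‖ω n x‖ = 1 ∧ ω n x (v n x) = ‖v n x‖)
    (hmeas : ∀ n k, Measurable fun x => ω n x (v k x))
    (I : ∀ x, E x →ₗᵢ[ℝ] 𝔹)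
    (hI : ∀ n, Measurable fun x => I x (v n x)) :
    (∀ x, IsClosed (Set.range (I x))) ∧
    (∀ x, ∃ S : Submodule ℝ 𝔹, (S : Set 𝔹) = Set.range (I x)) ∧
    (∀ U : Set 𝔹, IsOpen U → MeasurableSet {x | (Set.range (I x) ∩ U).Nonempty}) := by
  have hclosed (x : X) : IsClosed (range (I x)) := (I x).isometry.isClosedEmbedding.isClosed_range
  refine ⟨hclosed, fun x => ⟨LinearMap.range (I x).toLinearMap, rfl⟩,
    fun U hU => measurableSet_nonempty_inter_of_closure_range hI (fun x => ?_) hU⟩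
  refine Subset.antisymm ?_ (closure_minimal ?_ (hclosed x))
  · have h := (I x).continuous.range_subset_closure_image_dense (hdense x)
    rwa [← range_comp] at h
  · exact range_subset_iff.2 fun n => mem_range_self _
end

section
/- Let (X,Σ,m) be a σ-finite measure space, 𝔹 a separable Banach space, and E a separable Banach 𝔹-bundle over X. Then there exists a countable family (t_k)_{k∈ℕ} of bounded sections of E (measurable maps t_k : X → 𝔹 with t_k(x) ∈ E(x) for all x and sup_x ‖t_k(x)‖_𝔹 < ∞) such that for every section t of E and every ε > 0 there exist a countable measurable partition (A_j)_{j∈ℕ} of X and indices (k_j)_{j∈ℕ} with ‖t(x) − t_{k_j}(x)‖_𝔹 ≤ ε for m-a.e. x ∈ A_j, for every j ∈ ℕ. In particular, the normed L^0(m)-module of sections Γ(E) is countably generated. -/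
open MeasureTheory Set

/-- A measurable approximate selection with error `r` can be moved by at most `2 * r` to one with
error `r / 2`. -/
lemma exists_measurable_refine_approx_selection {X M : Type*} [MeasurableSpace X]
    [PseudoMetricSpace M] [TopologicalSpace.SeparableSpace M] [MeasurableSpace M] [BorelSpace M]
    {F : X → Set M} (hF : ∀ U, IsOpen U → MeasurableSet {x | (F x ∩ U).Nonempty})
    {r : ℝ} (hr : 0 < r) {g : X → M} (hg : Measurable g)
    (hgF : ∀ x, (F x ∩ Metric.ball (g x) r).Nonempty) :
    ∃ g' : X → M, Measurable g' ∧ (∀ x, (F x ∩ Metric.ball (g' x) (r / 2)).Nonempty) ∧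
      ∀ x, dist (g x) (g' x) ≤ 2 * r := by
  classical
  rcases isEmpty_or_nonempty X with hX | ⟨⟨x₀⟩⟩
  · exact ⟨g, hg, fun x => hX.elim x, fun x => hX.elim x⟩
  have : Nonempty M := ⟨g x₀⟩
  let d := TopologicalSpace.denseSeq M
  let p : X → ℕ → Prop := fun x n =>
    (F x ∩ Metric.ball (d n) (r / 2)).Nonempty ∧ g x ∈ Metric.ball (d n) (2 * r)
  have hp : ∀ x, ∃ n, p x n := by
    intro x
    obtain ⟨y, hyF, hy⟩ := hgF x
    obtain ⟨n, hn⟩ := (TopologicalSpace.denseRange_denseSeq M).exists_dist_lt y (half_pos hr)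
    refine ⟨n, ⟨y, hyF, hn⟩, ?_⟩
    rw [Metric.mem_ball] at hy ⊢
    have h : dist (g x) (d n) ≤ dist (g x) y + dist y (d n) := dist_triangle _ _ _
    rw [dist_comm (g x) y] at h
    linarith
  have hpm : ∀ n, MeasurableSet {x | p x n} := fun n =>
    (hF _ Metric.isOpen_ball).inter (hg Metric.isOpen_ball.measurableSet)
  refine ⟨fun x => d (Nat.find (hp x)), ?_, fun x => (Nat.find_spec (hp x)).1,
    fun x => (Metric.mem_ball.1 (Nat.find_spec (hp x)).2).le⟩
  exact (measurable_of_countable d).comp (measurable_find hp hpm)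

/-- A closed-valued measurable multifunction has a measurable selection uniformly close to any
given measurable approximate selection. -/
lemma exists_measurable_selection_near {X M : Type*} [MeasurableSpace X]
    [PseudoMetricSpace M] [CompleteSpace M] [TopologicalSpace.SeparableSpace M]
    [MeasurableSpace M] [BorelSpace M] {F : X → Set M} (hFclosed : ∀ x, IsClosed (F x))
    (hF : ∀ U, IsOpen U → MeasurableSet {x | (F x ∩ U).Nonempty})
    {r : ℝ} (hr : 0 < r) {g : X → M} (hg : Measurable g)
    (hgF : ∀ x, (F x ∩ Metric.ball (g x) r).Nonempty) :
    ∃ u : X → M, Measurable u ∧ (∀ x, u x ∈ F x) ∧ ∀ x, dist (g x) (u x) ≤ 4 * r := by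
  let S : ℕ → Type _ := fun n =>
    {f : X → M // Measurable f ∧ ∀ x, (F x ∩ Metric.ball (f x) (r / 2 ^ n)).Nonempty}
  have step : ∀ n (f : S n), ∃ f' : S (n + 1), ∀ x, dist (f.1 x) (f'.1 x) ≤ 2 * (r / 2 ^ n) := by
    intro n f
    obtain ⟨f', hf', hf'F, hd⟩ := exists_measurable_refine_approx_selection hF
      (by positivity : 0 < r / 2 ^ n) f.2.1 f.2.2
    refine ⟨⟨f', hf', fun x => ?_⟩, hd⟩
    rw [pow_succ, ← div_div]
    exact hf'F x
  choose next hnext using step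
  let a : ∀ n, S n := fun n =>
    Nat.rec (motive := S) ⟨g, hg, fun x => by simpa using hgF x⟩ next n
  have hdist : ∀ x n, dist ((a n).1 x) ((a (n + 1)).1 x) ≤ 4 * r / 2 / 2 ^ n := by
    intro x n
    refine (hnext n (a n) x).trans_eq ?_
    ring
  have hlim : ∀ x, ∃ y, Filter.Tendsto (fun n => (a n).1 x) Filter.atTop (nhds y) := fun x =>
    cauchySeq_tendsto_of_complete (cauchySeq_of_le_geometric_two (hdist x))
  choose u hu using hlim
  refine ⟨u, measurable_of_tendsto_metrizable (fun n => (a n).2.1) (tendsto_pi_nhds.2 hu),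
    fun x => ?_, fun x => dist_le_of_le_geometric_two_of_tendsto₀ (hdist x) (hu x)⟩
  choose y hyF hy using fun n => (a n).2.2 x
  refine (hFclosed x).mem_of_tendsto (f := y) (b := Filter.atTop) ?_
    (Filter.Eventually.of_forall hyF)
  have hr0 : Filter.Tendsto (fun n : ℕ => r / 2 ^ n) Filter.atTop (nhds 0) := by
    simpa [div_eq_mul_inv] using (tendsto_pow_atTop_nhds_zero_of_lt_one
      (by norm_num : (0 : ℝ) ≤ 2⁻¹) (by norm_num)).const_mul r
  refine (tendsto_iff_of_dist ?_).2 (hu x)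
  exact squeeze_zero (fun _ => dist_nonneg) (fun n => (Metric.mem_ball.1 (hy n)).le) hr0

/-- **The module of sections of a separable Banach bundle is countably generated.**
Let `(X, Σ, m)` be a σ-finite measure space, `𝔹` a separable Banach space and `E` a separable
Banach `𝔹`-bundle over `X`. Then there exists a countable family `(t_k)` of bounded sections
of `E` such that every section `t` of `E` can, for every `ε > 0`, be approximated up to `ε` on
the pieces of a countable measurable partition `(A_j)` of `X` by suitable `t_{k_j}`,
`m`-almost everywhere. In particular the normed `L⁰(m)`-module `Γ(E)` of sections is
countably generated. -/
theorem sections_countably_generated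
    {X : Type*} [MeasurableSpace X] (m : Measure X) [SigmaFinite m]
    {𝔹 : Type*} [NormedAddCommGroup 𝔹] [NormedSpace ℝ 𝔹] [CompleteSpace 𝔹]
    [TopologicalSpace.SeparableSpace 𝔹] [MeasurableSpace 𝔹] [BorelSpace 𝔹]
    (E : X → Submodule ℝ 𝔹) (hEclosed : ∀ x, IsClosed (E x : Set 𝔹))
    (hEmeas : ∀ U : Set 𝔹, IsOpen U → MeasurableSet {x | ((E x : Set 𝔹) ∩ U).Nonempty}) :
    ∃ t : ℕ → X → 𝔹,
      (∀ k, Measurable (t k) ∧ (∀ x, t k x ∈ E x) ∧ ∃ C : ℝ, ∀ x, ‖t k x‖ ≤ C) ∧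
      ∀ s : X → 𝔹, Measurable s → (∀ x, s x ∈ E x) → ∀ ε : ℝ, 0 < ε →
        ∃ (A : ℕ → Set X) (k : ℕ → ℕ),
          (∀ j, MeasurableSet (A j)) ∧
          (Pairwise fun i j => Disjoint (A i) (A j)) ∧
          (⋃ j, A j) = Set.univ ∧
          ∀ j, ∀ᵐ x ∂m, x ∈ A j → ‖s x - t (k j) x‖ ≤ ε := by
  classical
  let d := TopologicalSpace.denseSeq 𝔹
  let r : ℕ → ℝ := fun i => 1 / ((i : ℝ) + 1)
  have hr : ∀ i, 0 < r i := fun i => Nat.one_div_pos_of_nat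
  let S : ℕ → ℕ → Set X := fun n i => {x | ((E x : Set 𝔹) ∩ Metric.ball (d n) (r i)).Nonempty}
  have hS : ∀ n i, MeasurableSet (S n i) := fun n i => hEmeas _ Metric.isOpen_ball
  have hsel : ∀ n i, ∃ u : X → 𝔹, Measurable u ∧ (∀ x, u x ∈ (E x : Set 𝔹)) ∧
      ∀ x, dist ((S n i).indicator (fun _ => d n) x) (u x) ≤ 4 * r i := by
    intro n i
    refine exists_measurable_selection_near hEclosed hEmeas (hr i)
      (measurable_const.indicator (hS n i)) fun x => ?_
    by_cases hx : x ∈ S n i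
    · rw [indicator_of_mem hx]
      exact hx
    · rw [indicator_of_notMem hx]
      exact ⟨0, (E x).zero_mem, Metric.mem_ball_self (hr i)⟩
  choose u hum huE hud using hsel
  refine ⟨fun k => u k.unpair.1 k.unpair.2, fun k => ⟨hum _ _, huE _ _,
    ‖d k.unpair.1‖ + 4 * r k.unpair.2, fun x => ?_⟩, fun s hs hsE ε hε => ?_⟩
  · have h₁ := norm_indicator_le_norm_self (s := S k.unpair.1 k.unpair.2)
      (fun _ => d k.unpair.1) x
    have h₂ := hud k.unpair.1 k.unpair.2 x
    rw [dist_eq_norm'] at h₂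
    have h₃ := norm_le_norm_add_norm_sub
      ((S k.unpair.1 k.unpair.2).indicator (fun _ => d k.unpair.1) x)
      (u k.unpair.1 k.unpair.2 x)
    rw [norm_sub_rev] at h₃
    linarith
  · obtain ⟨i, hi⟩ := exists_nat_one_div_lt (by positivity : 0 < ε / 5)
    let B : ℕ → Set X := fun n => s ⁻¹' Metric.ball (d n) (r i)
    have hB : ∀ n, MeasurableSet (B n) := fun n => hs Metric.isOpen_ball.measurableSet
    refine ⟨disjointed B, fun n => Nat.pair n i, fun n => .disjointed hB n,
      disjoint_disjointed B, ?_, fun n => Filter.Eventually.of_forall fun x hx => ?_⟩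
    · rw [iUnion_disjointed, eq_univ_iff_forall]
      intro x
      obtain ⟨n, hn⟩ := (TopologicalSpace.denseRange_denseSeq 𝔹).exists_dist_lt (s x) (hr i)
      exact mem_iUnion.2 ⟨n, hn⟩
    · have hxB : s x ∈ Metric.ball (d n) (r i) := disjointed_subset B n hx
      have hxS : x ∈ S n i := ⟨s x, hsE x, hxB⟩
      have h := hud n i x
      rw [indicator_of_mem hxS] at h
      simp only [Nat.unpair_pair, ← dist_eq_norm]
      have htri := dist_triangle (s x) (d n) (u n i x)
      have hri : r i < ε / 5 := hi
      rw [Metric.mem_ball] at hxB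
      exact htri.trans (by linarith)
end

section
/- Let (X,Σ,m) be a σ-finite measure space and 𝔹 a universal separable Banach space. Let E, F be separable Banach 𝔹-bundles over X. Let Φ be a map sending sections of E to sections of F (defined on representatives) such that: Φ(s) and Φ(s') agree m-a.e. whenever s and s' agree m-a.e.; Φ(s + s') = Φ(s) + Φ(s') m-a.e.; Φ(f·s) = f·Φ(s) m-a.e. for every measurable f : X → ℝ and every section s of E with f·s a section of E (pointwise scalar multiplication); and ‖Φ(s)(x)‖_𝔹 ≤ ‖s(x)‖_𝔹 for m-a.e. x, for every section s. Then there exists a map φ̄ : TE → TF, where TE := {(x,v) ∈ X × 𝔹 : v ∈ E(x)} and TF := {(x,v) ∈ X × 𝔹 : v ∈ F(x)}, measurable with respect to the restriction of Σ ⊗ 𝓑(𝔹), such that φ̄({x} × E(x)) ⊆ {x} × F(x) for every x ∈ X, each φ̄(x,·) : E(x) → F(x) is a linear contraction, and Φ(s)(x) = φ̄(x, s(x)) for m-a.e. x ∈ X, for every section s of E. -/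
open MeasureTheory Set

universe u

open Filter Topology

section MeasurableSelection

variable {X : Type*} [MeasurableSpace X] {B : Type*} [NormedAddCommGroup B] [NormedSpace ℝ B]
  [TopologicalSpace.SeparableSpace B] [MeasurableSpace B] [BorelSpace B]

theorem measurable_infDist_of_weaklyMeasurable {E : X → Submodule ℝ B}
    (hE : ∀ U : Set B, IsOpen U → MeasurableSet {x | ((E x : Set B) ∩ U).Nonempty})
    {g : X → B} (hg : Measurable g) :
    Measurable fun x => Metric.infDist (g x) (E x : Set B) := by
  have := UniformSpace.secondCountable_of_separable B
  have h : Measurable (Function.uncurry fun (b : B) (x : X) => Metric.infDist b (E x : Set B)) := by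
    refine measurable_uncurry_of_continuous_of_measurable
      (fun x => Metric.continuous_infDist_pt _) fun b => measurable_of_Iio fun r => ?_
    have hset : (fun x => Metric.infDist b (E x : Set B)) ⁻¹' Iio r =
        {x | ((E x : Set B) ∩ Metric.ball b r).Nonempty} := by
      ext x
      rw [mem_preimage, mem_Iio, Metric.infDist_lt_iff (E x).nonempty]
      exact exists_congr fun y => and_congr_right fun _ => Metric.mem_ball'.symm
    rw [hset]
    exact hE _ Metric.isOpen_ball
  exact h.comp (f := fun x => (g x, x)) (hg.prodMk measurable_id)

theorem exists_measurable_infDist_le_half {E : X → Submodule ℝ B}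
    (hE : ∀ U : Set B, IsOpen U → MeasurableSet {x | ((E x : Set B) ∩ U).Nonempty})
    {g : X → B} (hg : Measurable g) :
    ∃ g' : X → B, Measurable g' ∧
      ∀ x, dist (g x) (g' x) ≤ 2 * Metric.infDist (g x) (E x : Set B) ∧
        Metric.infDist (g' x) (E x : Set B) ≤ Metric.infDist (g x) (E x : Set B) / 2 := by
  classical
  set b := TopologicalSpace.denseSeq B
  have hd := measurable_infDist_of_weaklyMeasurable hE hg
  set d : X → ℝ := fun x => Metric.infDist (g x) (E x : Set B) with hd_def
  set f : ℕ → X → B := fun n x => if d x = 0 then g x else b n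
  have h0 : MeasurableSet {x | d x = 0} := hd (measurableSet_singleton 0)
  have hf : ∀ n, Measurable (f n) := fun n => Measurable.ite h0 hg measurable_const
  have hp : ∀ n, MeasurableSet {x | dist (g x) (f n x) ≤ 2 * d x ∧
      Metric.infDist (f n x) (E x : Set B) ≤ d x / 2} := fun n =>
    (measurableSet_le (hg.dist (hf n)) (hd.const_mul 2)).inter
      (measurableSet_le (measurable_infDist_of_weaklyMeasurable hE (hf n)) (hd.div_const 2))
  have hex : ∀ x, ∃ n, dist (g x) (f n x) ≤ 2 * d x ∧
      Metric.infDist (f n x) (E x : Set B) ≤ d x / 2 := by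
    intro x
    by_cases hx : d x = 0
    · exact ⟨0, by simp [f, hx], by simp only [f, hx, if_true]; exact hx.le.trans (by simp)⟩
    · have hpos : 0 < d x := lt_of_le_of_ne Metric.infDist_nonneg (Ne.symm hx)
      obtain ⟨v, hv, hgv⟩ := (Metric.infDist_lt_iff (E x).nonempty).1
        (show Metric.infDist (g x) (E x : Set B) < 3 / 2 * d x by
          change d x < _; linarith)
      obtain ⟨n, hn⟩ := (TopologicalSpace.denseRange_denseSeq B).exists_dist_lt v (half_pos hpos)
      refine ⟨n, ?_, ?_⟩
      · simp only [f, hx, if_false]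
        linarith [dist_triangle (g x) v (b n)]
      · simp only [f, hx, if_false]
        exact (Metric.infDist_le_dist_of_mem hv).trans (by rw [dist_comm]; exact hn.le)
  exact ⟨_, Measurable.find hf hp hex, fun x => Nat.find_spec (hex x)⟩

theorem exists_measurable_section_dist_le [CompleteSpace B] {E : X → Submodule ℝ B}
    (hEclosed : ∀ x, IsClosed (E x : Set B))
    (hE : ∀ U : Set B, IsOpen U → MeasurableSet {x | ((E x : Set B) ∩ U).Nonempty})
    {g : X → B} (hg : Measurable g) :
    ∃ s : X → B, Measurable s ∧ (∀ x, s x ∈ E x) ∧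
      ∀ x, dist (g x) (s x) ≤ 4 * Metric.infDist (g x) (E x : Set B) := by
  choose! T hTm hT using fun (g : X → B) (hg : Measurable g) =>
    exists_measurable_infDist_le_half hE hg
  set u : ℕ → X → B := fun n => T^[n] g
  have hsucc : ∀ n, u (n + 1) = T (u n) := fun n => Function.iterate_succ_apply' T n g
  have hum : ∀ n, Measurable (u n) := by
    intro n
    induction n with
    | zero => exact hg
    | succ n ih => rw [hsucc]; exact hTm _ ih
  have hdist : ∀ x n, Metric.infDist (u n x) (E x : Set B) ≤
      Metric.infDist (g x) (E x : Set B) / 2 ^ n := by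
    intro x n
    induction n with
    | zero => simp [u]
    | succ n ih =>
      rw [hsucc, pow_succ, ← div_div]
      exact ((hT _ (hum n) x).2).trans (by gcongr)
  have hstep : ∀ x n, dist (u n x) (u (n + 1) x) ≤
      4 * Metric.infDist (g x) (E x : Set B) / 2 / 2 ^ n := by
    intro x n
    rw [hsucc]
    refine ((hT _ (hum n) x).1).trans ?_
    calc _ ≤ 2 * (Metric.infDist (g x) (E x : Set B) / 2 ^ n) := by gcongr; exact hdist x n
      _ = _ := by ring
  choose s hs using fun x => cauchySeq_tendsto_of_complete (cauchySeq_of_le_geometric_two (hstep x))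
  refine ⟨s, measurable_of_tendsto_metrizable hum (tendsto_pi_nhds.2 hs), fun x => ?_, fun x =>
    dist_le_of_le_geometric_two_of_tendsto₀ (hstep x) (hs x)⟩
  have hlim : Tendsto (fun n => Metric.infDist (u n x) (E x : Set B)) atTop (𝓝 0) := by
    refine squeeze_zero (fun _ => Metric.infDist_nonneg) (hdist x) ?_
    simpa [div_eq_mul_inv] using
      (tendsto_pow_atTop_nhds_zero_of_lt_one (r := (2 : ℝ)⁻¹) (by norm_num) (by norm_num)).const_mul
        (Metric.infDist (g x) (E x : Set B))
  have := tendsto_nhds_unique ((Metric.continuous_infDist_pt _).continuousAt.tendsto.comp (hs x)) hlim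
  exact ((hEclosed x).mem_iff_infDist_zero (E x).nonempty).2 this

/-- A Castaing representation of a measurable bundle of closed subspaces. -/
theorem exists_seq_measurable_section_dense [CompleteSpace B] {E : X → Submodule ℝ B}
    (hEclosed : ∀ x, IsClosed (E x : Set B))
    (hE : ∀ U : Set B, IsOpen U → MeasurableSet {x | ((E x : Set B) ∩ U).Nonempty}) :
    ∃ s : ℕ → X → B, (∀ n, Measurable (s n)) ∧ (∀ n x, s n x ∈ E x) ∧
      ∀ x, ∀ v ∈ E x, ∀ ε > 0, ∃ n, dist v (s n x) < ε := by
  choose s hsm hsE hs using fun n : ℕ => exists_measurable_section_dist_le hEclosed hE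
    (measurable_const (a := TopologicalSpace.denseSeq B n))
  refine ⟨s, hsm, hsE, fun x v hv ε hε => ?_⟩
  obtain ⟨n, hn⟩ := (TopologicalSpace.denseRange_denseSeq B).exists_dist_lt v
    (show 0 < ε / 5 by positivity)
  refine ⟨n, ?_⟩
  have h1 := hs n x
  have h2 := Metric.infDist_le_dist_of_mem (x := TopologicalSpace.denseSeq B n) hv
  rw [dist_comm _ v] at h2
  linarith [dist_triangle v (TopologicalSpace.denseSeq B n) (s n x)]

end MeasurableSelection

/-- A contractive assignment on a dense sequence extends to the points of its closure. -/
theorem exists_forall_dist_le_of_dist_le {α β : Type*} [PseudoMetricSpace α]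
    [MetricSpace β] [CompleteSpace β] {a : ℕ → α} {b : ℕ → β}
    (hab : ∀ n k, dist (b n) (b k) ≤ dist (a n) (a k)) {v : α}
    (hv : ∀ ε > 0, ∃ n, dist v (a n) < ε) :
    ∃ y, ∀ n, dist y (b n) ≤ dist v (a n) := by
  choose i hi using fun k : ℕ => hv (1 / (k + 1)) Nat.one_div_pos_of_nat
  have ha : Tendsto (fun k => a (i k)) atTop (𝓝 v) :=
    tendsto_iff_dist_tendsto_zero.2 <| squeeze_zero (fun _ => dist_nonneg)
      (fun k => by rw [dist_comm]; exact (hi k).le) tendsto_one_div_add_atTop_nhds_zero_nat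
  have hb : CauchySeq fun k => b (i k) := by
    rw [Metric.cauchySeq_iff']
    intro ε hε
    obtain ⟨N, hN⟩ := Metric.cauchySeq_iff'.1 ha.cauchySeq ε hε
    exact ⟨N, fun n hn => (hab _ _).trans_lt (hN n hn)⟩
  obtain ⟨y, hy⟩ := cauchySeq_tendsto_of_complete hb
  exact ⟨y, fun n => le_of_tendsto_of_tendsto' (hy.dist tendsto_const_nhds)
    (ha.dist tendsto_const_nhds) fun k => hab _ _⟩

section LinearExtension

variable {B : Type*} [NormedAddCommGroup B] [NormedSpace ℝ B]

theorem norm_smul_add_smul_sub_le_of_rat {a b c a' b' c' : B}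
    (h : ∀ p q : ℚ, ‖(p : ℝ) • a' + (q : ℝ) • b' - c'‖ ≤ ‖(p : ℝ) • a + (q : ℝ) • b - c‖)
    (p q : ℝ) : ‖p • a' + q • b' - c'‖ ≤ ‖p • a + q • b - c‖ := by
  have key : ∀ z : ℝ × ℝ, ‖z.1 • a' + z.2 • b' - c'‖ ≤ ‖z.1 • a + z.2 • b - c‖ := by
    intro z
    refine (Rat.denseRange_cast.prodMap Rat.denseRange_cast).induction_on
      (p := fun z : ℝ × ℝ => ‖z.1 • a' + z.2 • b' - c'‖ ≤ ‖z.1 • a + z.2 • b - c‖) z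
      (isClosed_le (by fun_prop) (by fun_prop)) fun r => h r.1 r.2
  exact key (p, q)

theorem smul_add_smul_eq_of_dist_le {a b : ℕ → B}
    (hab : ∀ n m k (p q : ℝ), ‖p • b n + q • b m - b k‖ ≤ ‖p • a n + q • a m - a k‖)
    {v w z v' w' z' : B} {p q : ℝ} (hz : z = p • v + q • w)
    (hv : ∀ ε > 0, ∃ n, dist v (a n) < ε) (hw : ∀ ε > 0, ∃ n, dist w (a n) < ε)
    (hzd : ∀ ε > 0, ∃ n, dist z (a n) < ε)
    (hv' : ∀ n, dist v' (b n) ≤ dist v (a n)) (hw' : ∀ n, dist w' (b n) ≤ dist w (a n))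
    (hz' : ∀ n, dist z' (b n) ≤ dist z (a n)) : z' = p • v' + q • w' := by
  have hseq : ∀ {t t' : B}, (∀ ε > 0, ∃ n, dist t (a n) < ε) →
      (∀ n, dist t' (b n) ≤ dist t (a n)) → ∃ i : ℕ → ℕ,
        Tendsto (fun k => a (i k)) atTop (𝓝 t) ∧ Tendsto (fun k => b (i k)) atTop (𝓝 t') := by
    intro t t' ht ht'
    choose i hi using fun k : ℕ => ht (1 / (k + 1)) Nat.one_div_pos_of_nat
    refine ⟨i, ?_, ?_⟩ <;> refine tendsto_iff_dist_tendsto_zero.2 <|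
      squeeze_zero (fun _ => dist_nonneg) (fun k => ?_) tendsto_one_div_add_atTop_nhds_zero_nat
    · rw [dist_comm]; exact (hi k).le
    · rw [dist_comm]; exact (ht' _).trans (hi k).le
  obtain ⟨i, hi, hi'⟩ := hseq hv hv'
  obtain ⟨j, hj, hj'⟩ := hseq hw hw'
  obtain ⟨l, hl, hl'⟩ := hseq hzd hz'
  have h := le_of_tendsto_of_tendsto'
    (((hi'.const_smul p).add (hj'.const_smul q)).sub hl').norm
    (((hi.const_smul p).add (hj.const_smul q)).sub hl).norm fun k => hab (i k) (j k) (l k) p q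
  rw [hz, sub_self, norm_zero] at h
  exact (sub_eq_zero.1 (norm_le_zero_iff.1 h)).symm

end LinearExtension

/-- **The section functor is full.**
Let `(X, Σ, m)` be a σ-finite measure space and `𝔹` a universal separable Banach space.
Let `E`, `F` be separable Banach `𝔹`-bundles over `X` and let `Φ` be a morphism of the
modules of sections (defined on representatives): it respects `m`-a.e. equality, is additive,
`L⁰(m)`-homogeneous and a pointwise contraction, all in the `m`-a.e. sense. Then there is a
pre-morphism `φ̄ : TE → TF`, i.e. a map preserving the fibers, measurable for the σ-algebra
restricted from `Σ ⊗ 𝓑(𝔹)`, whose fiber maps `φ̄(x,·) : E(x) → F(x)` are linear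
contractions, which induces `Φ`: `Φ(s)(x) = φ̄(x, s(x))` for `m`-a.e. `x`, for every
section `s` of `E`. -/
theorem section_functor_full
    {X : Type*} [MeasurableSpace X] (m : Measure X) [SigmaFinite m]
    {𝔹 : Type*} [NormedAddCommGroup 𝔹] [NormedSpace ℝ 𝔹] [CompleteSpace 𝔹]
    [TopologicalSpace.SeparableSpace 𝔹] [MeasurableSpace 𝔹] [BorelSpace 𝔹]
    (hUniv : ∀ (G : Type u) [NormedAddCommGroup G] [NormedSpace ℝ G] [CompleteSpace G]
      [TopologicalSpace.SeparableSpace G], Nonempty (G →ₗᵢ[ℝ] 𝔹))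
    (E F : X → Submodule ℝ 𝔹)
    (hEclosed : ∀ x, IsClosed (E x : Set 𝔹))
    (hEmeas : ∀ U : Set 𝔹, IsOpen U → MeasurableSet {x | ((E x : Set 𝔹) ∩ U).Nonempty})
    (hFclosed : ∀ x, IsClosed (F x : Set 𝔹))
    (hFmeas : ∀ U : Set 𝔹, IsOpen U → MeasurableSet {x | ((F x : Set 𝔹) ∩ U).Nonempty})
    (Φ : (X → 𝔹) → (X → 𝔹))
    (hΦsec : ∀ s : X → 𝔹, Measurable s → (∀ x, s x ∈ E x) →
      Measurable (Φ s) ∧ ∀ x, Φ s x ∈ F x)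
    (hΦae : ∀ s s' : X → 𝔹, Measurable s → (∀ x, s x ∈ E x) →
      Measurable s' → (∀ x, s' x ∈ E x) → s =ᵐ[m] s' → Φ s =ᵐ[m] Φ s')
    (hΦadd : ∀ s s' : X → 𝔹, Measurable s → (∀ x, s x ∈ E x) →
      Measurable s' → (∀ x, s' x ∈ E x) → Φ (s + s') =ᵐ[m] Φ s + Φ s')
    (hΦsmul : ∀ (f : X → ℝ) (s : X → 𝔹), Measurable f → Measurable s → (∀ x, s x ∈ E x) →
      Φ (fun x => f x • s x) =ᵐ[m] fun x => f x • Φ s x)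
    (hΦcontr : ∀ s : X → 𝔹, Measurable s → (∀ x, s x ∈ E x) →
      ∀ᵐ x ∂m, ‖Φ s x‖ ≤ ‖s x‖) :
    ∃ φ : X → 𝔹 → 𝔹,
      (∀ x, ∀ v ∈ E x, φ x v ∈ F x) ∧
      (∀ x, ∀ v ∈ E x, ∀ w ∈ E x, φ x (v + w) = φ x v + φ x w) ∧
      (∀ x (c : ℝ), ∀ v ∈ E x, φ x (c • v) = c • φ x v) ∧
      (∀ x, ∀ v ∈ E x, ‖φ x v‖ ≤ ‖v‖) ∧
      Measurable (fun p : {q : X × 𝔹 // q.2 ∈ E q.1} =>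
        (((p : X × 𝔹).1, φ (p : X × 𝔹).1 (p : X × 𝔹).2) : X × 𝔹)) ∧
      (∀ s : X → 𝔹, Measurable s → (∀ x, s x ∈ E x) →
        Φ s =ᵐ[m] fun x => φ x (s x)) := by
  classical
  obtain ⟨s, hsm, hsE, hsd⟩ := exists_seq_measurable_section_dense hEclosed hEmeas
  have hΦm : ∀ n, Measurable (Φ (s n)) := fun n => (hΦsec _ (hsm n) (hsE n)).1
  have hΦF : ∀ n x, Φ (s n) x ∈ F x := fun n => (hΦsec _ (hsm n) (hsE n)).2
  have hcomb : ∀ t t' r : X → 𝔹, Measurable t → (∀ x, t x ∈ E x) → Measurable t' →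
      (∀ x, t' x ∈ E x) → Measurable r → (∀ x, r x ∈ E x) → ∀ p q : ℝ,
      ∀ᵐ x ∂m, ‖p • Φ t x + q • Φ t' x - Φ r x‖ ≤ ‖p • t x + q • t' x - r x‖ := by
    intro t t' r ht htE ht' htE' hr hrE p q
    have m1 : Measurable fun x => p • t x := ht.const_smul p
    have m2 : Measurable fun x => q • t' x := ht'.const_smul q
    have m3 : Measurable fun x => (-1 : ℝ) • r x := hr.const_smul (-1 : ℝ)
    have e1 : ∀ x, p • t x ∈ E x := fun x => (E x).smul_mem _ (htE x)
    have e2 : ∀ x, q • t' x ∈ E x := fun x => (E x).smul_mem _ (htE' x)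
    have e3 : ∀ x, (-1 : ℝ) • r x ∈ E x := fun x => (E x).smul_mem _ (hrE x)
    have e12 : ∀ x, ((fun x => p • t x) + fun x => q • t' x) x ∈ E x :=
      fun x => (E x).add_mem (e1 x) (e2 x)
    filter_upwards [hΦsmul (fun _ => p) t measurable_const ht htE,
      hΦsmul (fun _ => q) t' measurable_const ht' htE',
      hΦsmul (fun _ => -1) r measurable_const hr hrE,
      hΦadd _ _ m1 e1 m2 e2, hΦadd _ _ (m1.add m2) e12 m3 e3,
      hΦcontr _ ((m1.add m2).add m3) fun x => (E x).add_mem (e12 x) (e3 x)]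
      with x h1 h2 h3 h4 h5 h6
    rw [h5, Pi.add_apply, h4, Pi.add_apply, h1, h2, h3] at h6
    simpa [sub_eq_add_neg] using h6
  set G : Set X := {x | ∀ (n k l : ℕ) (p q : ℚ),
    ‖(p : ℝ) • Φ (s n) x + (q : ℝ) • Φ (s k) x - Φ (s l) x‖ ≤
      ‖(p : ℝ) • s n x + (q : ℝ) • s k x - s l x‖} with hG
  have hGm : MeasurableSet G := by
    simp only [hG, ofPred_forall]
    refine .iInter fun n => .iInter fun k => .iInter fun l => .iInter fun p => .iInter fun q =>
      measurableSet_le ?_ ?_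
    · exact ((((hΦm n).const_smul (p : ℝ)).add ((hΦm k).const_smul (q : ℝ))).sub (hΦm l)).norm
    · exact ((((hsm n).const_smul (p : ℝ)).add ((hsm k).const_smul (q : ℝ))).sub (hsm l)).norm
  have hGae : ∀ᵐ x ∂m, x ∈ G := by
    simp only [hG, mem_ofPred_eq, ae_all_iff]
    exact fun n k l p q => hcomb _ _ _ (hsm n) (hsE n) (hsm k) (hsE k) (hsm l) (hsE l) p q
  have hGlin : ∀ x ∈ G, ∀ (n k l : ℕ) (p q : ℝ),
      ‖p • Φ (s n) x + q • Φ (s k) x - Φ (s l) x‖ ≤ ‖p • s n x + q • s k x - s l x‖ :=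
    fun x hx n k l => norm_smul_add_smul_sub_le_of_rat (hx n k l)
  have hex : ∀ x v, ∃ y, x ∈ G → v ∈ E x → ∀ n, dist y (Φ (s n) x) ≤ dist v (s n x) := by
    intro x v
    by_cases h : x ∈ G ∧ v ∈ E x
    · obtain ⟨y, hy⟩ := exists_forall_dist_le_of_dist_le (a := fun n => s n x)
        (b := fun n => Φ (s n) x)
        (fun n k => by simpa [dist_eq_norm] using hGlin x h.1 n n k 1 0) (hsd x v h.2)
      exact ⟨y, fun _ _ => hy⟩
    · exact ⟨0, fun h1 h2 => (h ⟨h1, h2⟩).elim⟩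
  choose ψ hψ using hex
  have hψlin : ∀ x ∈ G, ∀ v ∈ E x, ∀ w ∈ E x, ∀ p q : ℝ,
      ψ x (p • v + q • w) = p • ψ x v + q • ψ x w := by
    intro x hx v hv w hw p q
    have hz := (E x).add_mem ((E x).smul_mem p hv) ((E x).smul_mem q hw)
    exact smul_add_smul_eq_of_dist_le (hGlin x hx) rfl (hsd x v hv) (hsd x w hw) (hsd x _ hz)
      (hψ x v hx hv) (hψ x w hx hw) (hψ x _ hx hz)
  have hψF : ∀ x ∈ G, ∀ v ∈ E x, ψ x v ∈ F x := by
    intro x hx v hv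
    refine (hFclosed x).closure_subset (Metric.mem_closure_iff.2 fun ε hε => ?_)
    obtain ⟨n, hn⟩ := hsd x v hv ε hε
    exact ⟨_, hΦF n x, (hψ x v hx hv n).trans_lt hn⟩
  have hψnorm : ∀ x ∈ G, ∀ v ∈ E x, ‖ψ x v‖ ≤ ‖v‖ := by
    intro x hx v hv
    refine le_of_forall_pos_le_add fun ε hε => ?_
    obtain ⟨n, hn⟩ := hsd x v hv (ε / 2) (half_pos hε)
    have h1 := hψ x v hx hv n
    have h2 : ‖Φ (s n) x‖ ≤ ‖s n x‖ := by
      have h := hGlin x hx n n n 2 0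
      have e : ∀ y : 𝔹, (2 : ℝ) • y + (0 : ℝ) • y - y = y := fun y => by module
      rwa [e, e] at h
    have h3 := norm_le_norm_add_norm_sub' (ψ x v) (Φ (s n) x)
    have h4 := norm_le_norm_add_norm_sub' (s n x) v
    rw [← dist_eq_norm] at h3 h4
    rw [dist_comm] at h4
    linarith
  refine ⟨fun x v => if x ∈ G then ψ x v else 0, ?_, ?_, ?_, ?_, ?_, ?_⟩
  · intro x v hv
    by_cases hx : x ∈ G
    · simpa [hx] using hψF x hx v hv
    · simp [hx]
  · intro x v hv w hw
    by_cases hx : x ∈ G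
    · simpa [hx] using hψlin x hx v hv w hw 1 1
    · simp [hx]
  · intro x c v hv
    by_cases hx : x ∈ G
    · simpa [hx] using hψlin x hx v hv v hv c 0
    · simp [hx]
  · intro x v hv
    by_cases hx : x ∈ G
    · simpa [hx] using hψnorm x hx v hv
    · simp [hx]
  · have mx : Measurable fun p : {q : X × 𝔹 // q.2 ∈ E q.1} => (p : X × 𝔹).1 :=
      measurable_fst.comp measurable_subtype_coe
    have mv : Measurable fun p : {q : X × 𝔹 // q.2 ∈ E q.1} => (p : X × 𝔹).2 :=
      measurable_snd.comp measurable_subtype_coe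
    have hfind : ∀ (k : ℕ) (p : {q : X × 𝔹 // q.2 ∈ E q.1}),
        ∃ n, dist (p : X × 𝔹).2 (s n (p : X × 𝔹).1) < 1 / ((k : ℝ) + 1) :=
      fun k p => hsd _ _ p.2 _ Nat.one_div_pos_of_nat
    refine mx.prodMk (measurable_of_tendsto_metrizable (f := fun (k : ℕ)
      (p : {q : X × 𝔹 // q.2 ∈ E q.1}) => if (p : X × 𝔹).1 ∈ G then Φ (s (Nat.find (hfind k p))) (p : X × 𝔹).1 else 0)
      (fun k => ?_) (tendsto_pi_nhds.2 fun p => ?_))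
    · refine Measurable.ite (mx hGm) ?_ measurable_const
      exact Measurable.find (f := fun n (p : {q : X × 𝔹 // q.2 ∈ E q.1}) =>
        Φ (s n) (p : X × 𝔹).1) (fun n => (hΦm n).comp mx)
        (fun n => measurableSet_lt (mv.dist ((hsm n).comp mx)) measurable_const) (hfind k)
    · by_cases hx : (p : X × 𝔹).1 ∈ G
      · simp only [hx, if_true]
        refine tendsto_iff_dist_tendsto_zero.2 <| squeeze_zero (fun _ => dist_nonneg)
          (fun k => ?_) tendsto_one_div_add_atTop_nhds_zero_nat
        rw [dist_comm]
        exact (hψ _ _ hx p.2 _).trans (Nat.find_spec (hfind k p)).le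
      · simp [hx]
  · intro t ht htE
    have hcomp : ∀ᵐ x ∂m, ∀ n, dist (Φ t x) (Φ (s n) x) ≤ dist (t x) (s n x) := by
      refine ae_all_iff.2 fun n => ?_
      filter_upwards [hcomb t t (s n) ht htE ht htE (hsm n) (hsE n) 1 0] with x hx
      simpa [dist_eq_norm] using hx
    filter_upwards [hGae, hcomp] with x hx hc
    simpa [hx] using smul_add_smul_eq_of_dist_le (hGlin x hx) (p := 1) (q := 0)
      (show t x = (1 : ℝ) • t x + (0 : ℝ) • t x by simp) (hsd x _ (htE x)) (hsd x _ (htE x))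
      (hsd x _ (htE x)) (hψ x _ hx (htE x)) (hψ x _ hx (htE x)) hc
end

section
/- Let (X,Σ,m) be a σ-finite measure space and 𝔹 a universal separable Banach space. Let E, F be separable Banach 𝔹-bundles over X, and let φ̄, ψ̄ : TE → TF be two pre-morphisms, i.e., measurable maps with φ̄({x} × E(x)) ⊆ {x} × F(x) and ψ̄({x} × E(x)) ⊆ {x} × F(x) for every x, whose fiber maps φ̄(x,·), ψ̄(x,·) : E(x) → F(x) are linear contractions. If there exists a set P' ∈ Σ with m(P') > 0 and φ̄(x,·) ≠ ψ̄(x,·) for every x ∈ P', then there exist a section s of E and a set P ∈ Σ with P ⊆ P', m(P) > 0, and φ̄(x, s(x)) ≠ ψ̄(x, s(x)) for every x ∈ P. In particular, the section functor is faithful: if the induced maps on sections agree m-a.e. for every section, then φ̄(x,·) = ψ̄(x,·) for m-a.e. x ∈ X. -/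
open MeasureTheory Set

universe u

section MeasurableSelection

open Filter Topology Metric

variable {X α : Type*} [MeasurableSpace X] [MetricSpace α] [TopologicalSpace.SeparableSpace α]
  [MeasurableSpace α] [BorelSpace α]

/-- If a weakly measurable multifunction `C` stays within distance `r` of a measurable map `g`,
then `g` can be moved by less than `r` so as to stay within distance `r / 2` of `C`. -/
theorem exists_measurable_halving_dist {C : X → Set α}
    (hC : ∀ U : Set α, IsOpen U → MeasurableSet {x | (C x ∩ U).Nonempty})
    {g : X → α} (hg : Measurable g) {r : ℝ} (hr : 0 < r)
    (h : ∀ x, (C x ∩ ball (g x) r).Nonempty) :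
    ∃ g' : X → α, Measurable g' ∧ (∀ x, (C x ∩ ball (g' x) (r / 2)).Nonempty) ∧
      ∀ x, dist (g x) (g' x) < r := by
  classical
  rcases isEmpty_or_nonempty X with hX | ⟨⟨x₀⟩⟩
  · exact ⟨g, hg, fun x => hX.elim x, fun x => hX.elim x⟩
  have : Nonempty α := ⟨g x₀⟩
  set d := TopologicalSpace.denseSeq α
  have hd : DenseRange d := TopologicalSpace.denseRange_denseSeq α
  have hex : ∀ x, ∃ n, (C x ∩ ball (d n) (r / 2)).Nonempty ∧ dist (g x) (d n) < r := by
    intro x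
    obtain ⟨y, hyC, hy⟩ := h x
    obtain ⟨n, hn⟩ := hd.exists_mem_open (isOpen_ball.inter isOpen_ball)
      (⟨y, hy, mem_ball_self (half_pos hr)⟩ : (ball (g x) r ∩ ball y (r / 2)).Nonempty)
    exact ⟨n, ⟨y, hyC, mem_ball_comm.1 hn.2⟩, mem_ball'.1 hn.1⟩
  have hmeas : ∀ n, MeasurableSet
      {x | (C x ∩ ball (d n) (r / 2)).Nonempty ∧ dist (g x) (d n) < r} := fun n =>
    (hC _ isOpen_ball).inter (hg measurableSet_ball)
  exact ⟨fun x => d (Nat.find (hex x)), measurable_from_nat.comp (measurable_find hex hmeas),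
    fun x => (Nat.find_spec (hex x)).1, fun x => (Nat.find_spec (hex x)).2⟩

/-- Quantitative form of the Kuratowski–Ryll-Nardzewski selection theorem. -/
theorem exists_measurable_selection_dist_le_s13 [CompleteSpace α] {C : X → Set α}
    (hCc : ∀ x, IsClosed (C x))
    (hC : ∀ U : Set α, IsOpen U → MeasurableSet {x | (C x ∩ U).Nonempty})
    {g : X → α} (hg : Measurable g) {r : ℝ} (hr : 0 < r)
    (h : ∀ x, (C x ∩ ball (g x) r).Nonempty) :
    ∃ s : X → α, Measurable s ∧ (∀ x, s x ∈ C x) ∧ ∀ x, dist (g x) (s x) ≤ 2 * r := by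
  have hpos : ∀ n : ℕ, 0 < r / 2 ^ n := fun n => by positivity
  choose! T hTm hTC hTd using fun (n : ℕ) (f : X → α)
    (hf : Measurable f ∧ ∀ x, (C x ∩ ball (f x) (r / 2 ^ n)).Nonempty) =>
      exists_measurable_halving_dist hC hf.1 (hpos n) hf.2
  let G : ℕ → X → α := fun n => Nat.rec g (fun n f => T n f) n
  have hG : ∀ n, Measurable (G n) ∧ ∀ x, (C x ∩ ball (G n x) (r / 2 ^ n)).Nonempty := by
    intro n
    induction n with
    | zero => exact ⟨hg, by simpa [G] using h⟩
    | succ n ih =>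
      refine ⟨hTm n _ ih, fun x => ?_⟩
      rw [pow_succ, ← div_div]
      exact hTC n _ ih x
  have hdist : ∀ x n, dist (G n x) (G (n + 1) x) ≤ 2 * r / 2 / 2 ^ n := by
    intro x n
    rw [mul_div_cancel_left₀ r two_ne_zero]
    exact (hTd n _ (hG n) x).le
  choose s hs using fun x => cauchySeq_tendsto_of_complete (cauchySeq_of_le_geometric_two (hdist x))
  refine ⟨s, measurable_of_tendsto_metrizable (fun n => (hG n).1) (tendsto_pi_nhds.2 hs),
    fun x => ?_, fun x => dist_le_of_le_geometric_two_of_tendsto₀ (hdist x) (hs x)⟩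
  choose y hyC hy using fun n => (hG n).2 x
  have hlim : Tendsto (fun n : ℕ => r / 2 ^ n) atTop (𝓝 0) :=
    tendsto_const_nhds.div_atTop (tendsto_pow_atTop_atTop_of_one_lt one_lt_two)
  have hyd : Tendsto (fun n => dist (G n x) (y n)) atTop (𝓝 0) :=
    squeeze_zero (fun _ => dist_nonneg) (fun n => (mem_ball'.1 (hy n)).le) hlim
  exact (hCc x).mem_of_tendsto ((tendsto_iff_of_dist hyd).1 (hs x)) (Eventually.of_forall hyC)

/-- Castaing representation: a weakly measurable multifunction with closed values and one
measurable selection has a countable family of measurable selections that is pointwise dense. -/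
theorem exists_measurable_selections_dense [CompleteSpace α] {C : X → Set α}
    (hCc : ∀ x, IsClosed (C x))
    (hC : ∀ U : Set α, IsOpen U → MeasurableSet {x | (C x ∩ U).Nonempty})
    {s₀ : X → α} (hs₀ : Measurable s₀) (hs₀C : ∀ x, s₀ x ∈ C x) :
    ∃ s : ℕ × ℕ → X → α, (∀ i, Measurable (s i)) ∧ (∀ i x, s i x ∈ C x) ∧
      ∀ x, C x ⊆ closure (range fun i => s i x) := by
  classical
  rcases isEmpty_or_nonempty X with hX | ⟨⟨x₀⟩⟩
  · exact ⟨fun _ => s₀, fun _ => hs₀, fun _ => hs₀C, fun x => hX.elim x⟩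
  have : Nonempty α := ⟨s₀ x₀⟩
  set d := TopologicalSpace.denseSeq α
  have hd : DenseRange d := TopologicalSpace.denseRange_denseSeq α
  have hpos : ∀ n : ℕ, (0 : ℝ) < 1 / (n + 1) := fun n => Nat.one_div_pos_of_nat
  let A : ℕ × ℕ → Set X := fun i => {x | (C x ∩ ball (d i.1) (1 / (i.2 + 1))).Nonempty}
  have hA : ∀ i, MeasurableSet (A i) := fun i => hC _ isOpen_ball
  have hnear : ∀ i x, (C x ∩
      ball ((A i).piecewise (fun _ => d i.1) s₀ x) (1 / (i.2 + 1))).Nonempty := by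
    intro i x
    by_cases hx : x ∈ A i
    · rw [piecewise_eq_of_mem _ _ _ hx]
      exact hx
    · rw [piecewise_eq_of_notMem _ _ _ hx]
      exact ⟨s₀ x, hs₀C x, mem_ball_self (hpos _)⟩
  choose s hsm hsC hsd using fun i => exists_measurable_selection_dist_le_s13 hCc hC
    (Measurable.piecewise (hA i) measurable_const hs₀) (hpos i.2) (hnear i)
  refine ⟨s, hsm, hsC, fun x v hv => Metric.mem_closure_range_iff.2 fun ε hε => ?_⟩
  obtain ⟨j, hj⟩ := exists_nat_one_div_lt (show 0 < ε / 3 by positivity)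
  obtain ⟨k, hk⟩ := hd.exists_dist_lt v (hpos j)
  have hx : x ∈ A (k, j) := ⟨v, hv, hk⟩
  have hsk := hsd (k, j) x
  rw [piecewise_eq_of_mem _ _ _ hx] at hsk
  refine ⟨(k, j), (dist_triangle v (d k) _).trans_lt ?_⟩
  dsimp only at hsk
  linarith

end MeasurableSelection

/-- A map that is additive, homogeneous and contractive on a subspace is continuous there. -/
theorem continuousOn_of_linear_contraction {V W : Type*} [NormedAddCommGroup V] [NormedSpace ℝ V]
    [NormedAddCommGroup W] [NormedSpace ℝ W] (S : Submodule ℝ V) {f : V → W}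
    (hadd : ∀ v ∈ S, ∀ w ∈ S, f (v + w) = f v + f w)
    (hsmul : ∀ c : ℝ, ∀ v ∈ S, f (c • v) = c • f v)
    (hcontr : ∀ v ∈ S, ‖f v‖ ≤ ‖v‖) : ContinuousOn f S := by
  refine (LipschitzOnWith.of_dist_le_mul (K := 1) fun v hv w hw => ?_).continuousOn
  have hneg := hsmul (-1) w hw
  rw [neg_one_smul, neg_one_smul] at hneg
  have hsub := hcontr _ (S.sub_mem hv hw)
  rw [sub_eq_add_neg, hadd v hv _ (S.neg_mem hw), hneg] at hsub
  simpa [dist_eq_norm, sub_eq_add_neg] using hsub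

/-- A fiberwise map that is measurable on the total space takes measurable sections to measurable
maps. -/
theorem measurable_fiberwise_comp {X V W : Type*} [MeasurableSpace X] [MeasurableSpace V]
    [MeasurableSpace W] {C : X → Set V} {φ : X → V → W}
    (hφ : Measurable (fun p : {q : X × V // q.2 ∈ C q.1} =>
      (((p : X × V).1, φ (p : X × V).1 (p : X × V).2) : X × W)))
    {s : X → V} (hs : Measurable s) (hsC : ∀ x, s x ∈ C x) :
    Measurable fun x => φ x (s x) :=
  (hφ.comp ((measurable_id.prodMk hs).subtype_mk (h := hsC))).snd

/-- **The section functor is faithful.**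
Let `(X, Σ, m)` be a σ-finite measure space and `𝔹` a universal separable Banach space.
Let `E`, `F` be separable Banach `𝔹`-bundles over `X` and let `φ̄`, `ψ̄ : TE → TF` be two
pre-morphisms (measurable maps preserving the fibers whose fiber maps are linear
contractions). If `φ̄(x,·) ≠ ψ̄(x,·)` for every `x` in a set `P'` of positive measure, then
there are a section `s` of `E` and a subset `P ⊆ P'` of positive measure with
`φ̄(x, s(x)) ≠ ψ̄(x, s(x))` for every `x ∈ P`. In particular, if the induced maps on
sections agree `m`-a.e. for every section, then `φ̄(x,·) = ψ̄(x,·)` for `m`-a.e. `x`. -/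
theorem section_functor_faithful
    {X : Type*} [MeasurableSpace X] (m : Measure X) [SigmaFinite m]
    {𝔹 : Type*} [NormedAddCommGroup 𝔹] [NormedSpace ℝ 𝔹] [CompleteSpace 𝔹]
    [TopologicalSpace.SeparableSpace 𝔹] [MeasurableSpace 𝔹] [BorelSpace 𝔹]
    (hUniv : ∀ (G : Type u) [NormedAddCommGroup G] [NormedSpace ℝ G] [CompleteSpace G]
      [TopologicalSpace.SeparableSpace G], Nonempty (G →ₗᵢ[ℝ] 𝔹))
    (E F : X → Submodule ℝ 𝔹)
    (hEclosed : ∀ x, IsClosed (E x : Set 𝔹))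
    (hEmeas : ∀ U : Set 𝔹, IsOpen U → MeasurableSet {x | ((E x : Set 𝔹) ∩ U).Nonempty})
    (hFclosed : ∀ x, IsClosed (F x : Set 𝔹))
    (hFmeas : ∀ U : Set 𝔹, IsOpen U → MeasurableSet {x | ((F x : Set 𝔹) ∩ U).Nonempty})
    (φ ψ : X → 𝔹 → 𝔹)
    (hφfib : ∀ x, ∀ v ∈ E x, φ x v ∈ F x)
    (hφadd : ∀ x, ∀ v ∈ E x, ∀ w ∈ E x, φ x (v + w) = φ x v + φ x w)
    (hφsmul : ∀ x (c : ℝ), ∀ v ∈ E x, φ x (c • v) = c • φ x v)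
    (hφcontr : ∀ x, ∀ v ∈ E x, ‖φ x v‖ ≤ ‖v‖)
    (hφmeas : Measurable (fun p : {q : X × 𝔹 // q.2 ∈ E q.1} =>
      (((p : X × 𝔹).1, φ (p : X × 𝔹).1 (p : X × 𝔹).2) : X × 𝔹)))
    (hψfib : ∀ x, ∀ v ∈ E x, ψ x v ∈ F x)
    (hψadd : ∀ x, ∀ v ∈ E x, ∀ w ∈ E x, ψ x (v + w) = ψ x v + ψ x w)
    (hψsmul : ∀ x (c : ℝ), ∀ v ∈ E x, ψ x (c • v) = c • ψ x v)
    (hψcontr : ∀ x, ∀ v ∈ E x, ‖ψ x v‖ ≤ ‖v‖)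
    (hψmeas : Measurable (fun p : {q : X × 𝔹 // q.2 ∈ E q.1} =>
      (((p : X × 𝔹).1, ψ (p : X × 𝔹).1 (p : X × 𝔹).2) : X × 𝔹))) :
    (∀ P' : Set X, MeasurableSet P' → 0 < m P' →
      (∀ x ∈ P', ∃ v ∈ E x, φ x v ≠ ψ x v) →
      ∃ s : X → 𝔹, Measurable s ∧ (∀ x, s x ∈ E x) ∧
        ∃ P : Set X, MeasurableSet P ∧ P ⊆ P' ∧ 0 < m P ∧
          ∀ x ∈ P, φ x (s x) ≠ ψ x (s x)) ∧
    ((∀ s : X → 𝔹, Measurable s → (∀ x, s x ∈ E x) →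
        (fun x => φ x (s x)) =ᵐ[m] fun x => ψ x (s x)) →
      ∀ᵐ x ∂m, ∀ v ∈ E x, φ x v = ψ x v) := by
  have : SecondCountableTopology 𝔹 := UniformSpace.secondCountable_of_separable 𝔹
  obtain ⟨s, hsm, hsE, hsd⟩ := exists_measurable_selections_dense (C := fun x => (E x : Set 𝔹))
    hEclosed hEmeas (s₀ := fun _ => 0) measurable_const fun x => (E x).zero_mem
  have heq : ∀ x, (∀ i, φ x (s i x) = ψ x (s i x)) → ∀ v ∈ E x, φ x v = ψ x v := by
    intro x hx
    have hrange : range (fun i => s i x) ⊆ E x := range_subset_iff.2 fun i => hsE i x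
    have hon : EqOn (φ x) (ψ x) (range fun i => s i x) := by
      rintro _ ⟨i, rfl⟩
      exact hx i
    exact hon.of_subset_closure
      (continuousOn_of_linear_contraction (E x) (hφadd x) (hφsmul x) (hφcontr x))
      (continuousOn_of_linear_contraction (E x) (hψadd x) (hψsmul x) (hψcontr x)) hrange (hsd x)
  refine ⟨fun P' hP' hpos hne => ?_, fun hsec => ?_⟩
  · let A : ℕ × ℕ → Set X := fun i => {x | φ x (s i x) ≠ ψ x (s i x)}
    have hA : ∀ i, MeasurableSet (A i) := fun i =>
      (measurableSet_eq_fun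
        (measurable_fiberwise_comp (C := fun x => (E x : Set 𝔹)) hφmeas (hsm i) (hsE i))
        (measurable_fiberwise_comp (C := fun x => (E x : Set 𝔹)) hψmeas (hsm i) (hsE i))).compl
    have hcover : P' ⊆ ⋃ i, P' ∩ A i := by
      intro x hx
      obtain ⟨v, hv, hvne⟩ := hne x hx
      by_contra hcon
      refine hvne (heq x (fun i => ?_) v hv)
      by_contra hi
      exact hcon (mem_iUnion.2 ⟨i, hx, hi⟩)
    obtain ⟨i, hi⟩ := exists_measure_pos_of_not_measure_iUnion_null
      (hpos.trans_le (measure_mono hcover)).ne'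
    exact ⟨s i, hsm i, hsE i, P' ∩ A i, hP'.inter (hA i), inter_subset_left, hi, fun x hx => hx.2⟩
  · filter_upwards [ae_all_iff.2 fun i => hsec (s i) (hsm i) (hsE i)] with x hx
    exact heq x hx
end

section
/- Let (X,d_X,m_X) and (Y,d_Y,m_Y) be complete separable metric spaces equipped with finite Borel measures, let φ : X → Y be a Borel map with φ_*m_X = m_Y, let 𝔹 be a separable Banach space, and let E be a separable Banach 𝔹-bundle over Y. Then for every bounded section t of the pullback bundle φ*E (i.e., a bounded measurable map t : X → 𝔹 with t(x) ∈ E(φ(x)) for every x) and every ε > 0, there exist a Borel partition (A_n)_{n∈ℕ} of X and sections s_n of E such that ‖t(x) − s_n(φ(x))‖_𝔹 ≤ ε for m_X-a.e. x ∈ A_n, for every n ∈ ℕ. In particular, the family {s ∘ φ : s a section of E} generates the space of sections of φ*E, and hence φ*Γ(E) ≅ Γ(φ*E). -/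
open MeasureTheory Set

theorem MeasureTheory.exists_measurable_index_ball_inter {Y α : Type*} [MeasurableSpace Y]
    [PseudoMetricSpace α] {F : Y → Set α}
    (hFmeas : ∀ U : Set α, IsOpen U → MeasurableSet {y | (F y ∩ U).Nonempty})
    {d : ℕ → α} (hd : DenseRange d) {g : Y → ℕ} (hg : Measurable g) {r r' : ℝ}
    (hgF : ∀ y, (F y ∩ Metric.ball (d (g y)) r).Nonempty) (hr' : 0 < r') :
    ∃ g' : Y → ℕ, Measurable g' ∧
      ∀ y, (F y ∩ (Metric.ball (d (g y)) r ∩ Metric.ball (d (g' y)) r')).Nonempty := by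
  classical
  have hex : ∀ y, ∃ n, (F y ∩ (Metric.ball (d (g y)) r ∩ Metric.ball (d n) r')).Nonempty := by
    intro y
    obtain ⟨z, hzF, hz⟩ := hgF y
    obtain ⟨n, hn⟩ := hd.exists_dist_lt z hr'
    exact ⟨n, z, hzF, hz, hn⟩
  refine ⟨fun y => Nat.find (hex y), measurable_find hex fun n => ?_, fun y => Nat.find_spec (hex y)⟩
  have hunion : {y | (F y ∩ (Metric.ball (d (g y)) r ∩ Metric.ball (d n) r')).Nonempty} =
      ⋃ m, g ⁻¹' {m} ∩ {y | (F y ∩ (Metric.ball (d m) r ∩ Metric.ball (d n) r')).Nonempty} := by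
    ext y
    simp
  rw [hunion]
  exact .iUnion fun m => (hg (measurableSet_singleton m)).inter
    (hFmeas _ (Metric.isOpen_ball.inter Metric.isOpen_ball))

/-- **Kuratowski–Ryll-Nardzewski measurable selection theorem.** -/
theorem MeasureTheory.exists_measurable_selection {Y α : Type*} [MeasurableSpace Y]
    [PseudoMetricSpace α] [CompleteSpace α] [TopologicalSpace.SeparableSpace α] [Nonempty α]
    [MeasurableSpace α] [BorelSpace α] {F : Y → Set α} (hFclosed : ∀ y, IsClosed (F y))
    (hFne : ∀ y, (F y).Nonempty)
    (hFmeas : ∀ U : Set α, IsOpen U → MeasurableSet {y | (F y ∩ U).Nonempty}) :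
    ∃ f : Y → α, Measurable f ∧ ∀ y, f y ∈ F y := by
  classical
  let d := TopologicalSpace.denseSeq α
  have hd : DenseRange d := TopologicalSpace.denseRange_denseSeq α
  let r : ℕ → ℝ := fun k => (1 / 2) ^ k
  have hrpos : ∀ k, 0 < r k := fun k => by positivity
  have hinit : ∃ g : Y → ℕ, Measurable g ∧
      ∀ y, (F y ∩ Metric.ball (d (g y)) (r 0)).Nonempty := by
    have hex : ∀ y, ∃ n, (F y ∩ Metric.ball (d n) (r 0)).Nonempty := fun y => by
      obtain ⟨z, hz⟩ := hFne y
      obtain ⟨n, hn⟩ := hd.exists_dist_lt z (hrpos 0)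
      exact ⟨n, z, hz, hn⟩
    exact ⟨fun y => Nat.find (hex y),
      measurable_find hex fun n => hFmeas _ Metric.isOpen_ball, fun y => Nat.find_spec (hex y)⟩
  obtain ⟨g₀, hg₀, hg₀F⟩ := hinit
  choose! next hnext hnextF using fun k (g : Y → ℕ)
      (h : Measurable g ∧ ∀ y, (F y ∩ Metric.ball (d (g y)) (r k)).Nonempty) =>
    exists_measurable_index_ball_inter hFmeas hd h.1 h.2 (hrpos (k + 1))
  let g : ℕ → Y → ℕ := fun k => Nat.rec g₀ next k
  have hg : ∀ k, Measurable (g k) ∧ ∀ y, (F y ∩ Metric.ball (d (g k y)) (r k)).Nonempty := by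
    intro k
    induction k with
    | zero => exact ⟨hg₀, hg₀F⟩
    | succ k ih =>
      exact ⟨hnext k _ ih, fun y => (hnextF k _ ih y).mono fun z hz => ⟨hz.1, hz.2.2⟩⟩
  have hdist : ∀ y k, dist (d (g k y)) (d (g (k + 1) y)) ≤ 2 * (1 / 2) ^ k := by
    intro y k
    obtain ⟨z, -, hz, hz'⟩ := hnextF k _ (hg k) y
    have h₁ : dist z (d (g k y)) < (1 / 2) ^ k := hz
    have h₂ : dist z (d (g (k + 1) y)) < (1 / 2) ^ (k + 1) := hz'
    have h₃ := dist_triangle_left (d (g k y)) (d (g (k + 1) y)) z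
    have h₄ : (0 : ℝ) < (1 / 2) ^ k := hrpos k
    rw [pow_succ] at h₂
    linarith
  choose f hf using fun y => cauchySeq_tendsto_of_complete
    (cauchySeq_of_le_geometric (1 / 2) 2 (by norm_num) (hdist y))
  refine ⟨f, measurable_of_tendsto_metrizable
    (fun k => measurable_from_nat.comp (hg k).1) (tendsto_pi_nhds.2 hf), fun y => ?_⟩
  choose z hzF hz using fun k => (hg k).2 y
  refine (hFclosed y).mem_of_tendsto (f := z) (b := Filter.atTop) ?_ (.of_forall hzF)
  refine (tendsto_iff_of_dist ?_).1 (hf y)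
  refine squeeze_zero (fun _ => dist_nonneg) (fun k => ?_)
    (tendsto_pow_atTop_nhds_zero_of_lt_one (r := (1 / 2 : ℝ)) (by norm_num) (by norm_num))
  rw [dist_comm]
  exact (Metric.mem_ball.1 (hz k)).le

theorem MeasureTheory.exists_measurable_selection_mem_closure_inter {Y α : Type*}
    [MeasurableSpace Y] [PseudoMetricSpace α] [CompleteSpace α]
    [TopologicalSpace.SeparableSpace α] [Nonempty α] [MeasurableSpace α] [BorelSpace α]
    {F : Y → Set α} (hFclosed : ∀ y, IsClosed (F y)) (hFne : ∀ y, (F y).Nonempty)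
    (hFmeas : ∀ U : Set α, IsOpen U → MeasurableSet {y | (F y ∩ U).Nonempty})
    {V : Set α} (hV : IsOpen V) :
    ∃ f : Y → α, Measurable f ∧ (∀ y, f y ∈ F y) ∧
      ∀ y, (F y ∩ V).Nonempty → f y ∈ closure V := by
  classical
  let G : Y → Set α := fun y => if (F y ∩ V).Nonempty then closure (F y ∩ V) else F y
  have hG : ∀ y, G y ⊆ F y := fun y => by
    by_cases h : (F y ∩ V).Nonempty
    · simpa only [G, if_pos h] using closure_minimal inter_subset_left (hFclosed y)
    · simp only [G, if_neg h, subset_refl]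
  obtain ⟨f, hfm, hf⟩ := exists_measurable_selection (F := G)
    (fun y => by
      by_cases h : (F y ∩ V).Nonempty
      · simp only [G, if_pos h, isClosed_closure]
      · simpa only [G, if_neg h] using hFclosed y)
    (fun y => by
      by_cases h : (F y ∩ V).Nonempty
      · simpa only [G, if_pos h] using h.closure
      · simpa only [G, if_neg h] using hFne y)
    (fun U hU => by
      have hset : {y | (G y ∩ U).Nonempty} = {y | (F y ∩ V).Nonempty}.ite
          {y | (F y ∩ (V ∩ U)).Nonempty} {y | (F y ∩ U).Nonempty} := by
        ext y
        by_cases h : (F y ∩ V).Nonempty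
        · simp [G, Set.ite, h, closure_inter_open_nonempty_iff hU, inter_assoc]
        · simp [G, Set.ite, h]
      rw [hset]
      exact (hFmeas V hV).ite (hFmeas _ (hV.inter hU)) (hFmeas U hU))
  refine ⟨f, hfm, fun y => hG y (hf y), fun y h => ?_⟩
  have hfy := hf y
  simp only [G, if_pos h] at hfy
  exact closure_mono inter_subset_right hfy

/-- **Pullback and section functors commute.**
Let `(X, d_X, m_X)`, `(Y, d_Y, m_Y)` be complete separable metric spaces with finite Borel
measures, `φ : X → Y` Borel with `φ_* m_X = m_Y`, `𝔹` a separable Banach space and `E` a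
separable Banach `𝔹`-bundle over `Y`. Then every bounded section `t` of the pullback bundle
`φ*E` can, for every `ε > 0`, be approximated up to `ε` (in the `m_X`-a.e. sense) on each
piece of a countable Borel partition `(Aₙ)` of `X` by pullbacks `sₙ ∘ φ` of sections `sₙ`
of `E`. In particular `{s ∘ φ : s ∈ Γ(E)}` generates `Γ(φ*E)` and hence
`φ*Γ(E) ≅ Γ(φ*E)`. -/
theorem pullback_sections_generate
    {X Y : Type*}
    [MetricSpace X] [CompleteSpace X] [TopologicalSpace.SeparableSpace X]
    [MeasurableSpace X] [BorelSpace X]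
    [MetricSpace Y] [CompleteSpace Y] [TopologicalSpace.SeparableSpace Y]
    [MeasurableSpace Y] [BorelSpace Y]
    (mX : Measure X) (mY : Measure Y) [IsFiniteMeasure mX] [IsFiniteMeasure mY]
    (φ : X → Y) (hφ : Measurable φ) (hpush : mX.map φ = mY)
    {𝔹 : Type*} [NormedAddCommGroup 𝔹] [NormedSpace ℝ 𝔹] [CompleteSpace 𝔹]
    [TopologicalSpace.SeparableSpace 𝔹] [MeasurableSpace 𝔹] [BorelSpace 𝔹]
    (E : Y → Submodule ℝ 𝔹) (hEclosed : ∀ y, IsClosed (E y : Set 𝔹))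
    (hEmeas : ∀ U : Set 𝔹, IsOpen U → MeasurableSet {y | ((E y : Set 𝔹) ∩ U).Nonempty}) :
    ∀ t : X → 𝔹, Measurable t → (∀ x, t x ∈ E (φ x)) → (∃ C : ℝ, ∀ x, ‖t x‖ ≤ C) →
      ∀ ε : ℝ, 0 < ε →
        ∃ (A : ℕ → Set X) (s : ℕ → Y → 𝔹),
          (∀ n, MeasurableSet (A n)) ∧
          (Pairwise fun i j => Disjoint (A i) (A j)) ∧
          (⋃ n, A n) = Set.univ ∧
          (∀ n, Measurable (s n) ∧ ∀ y, s n y ∈ E y) ∧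
          ∀ n, ∀ᵐ x ∂mX, x ∈ A n → ‖t x - s n (φ x)‖ ≤ ε := by
  intro t ht htE _ ε hε
  let b := TopologicalSpace.denseSeq 𝔹
  have hb : DenseRange b := TopologicalSpace.denseRange_denseSeq 𝔹
  choose s hsm hsE hs using fun n => exists_measurable_selection_mem_closure_inter
    (F := fun y => (E y : Set 𝔹)) hEclosed (fun y => ⟨0, (E y).zero_mem⟩) hEmeas
    (Metric.isOpen_ball (x := b n) (ε := ε / 2))
  let B : ℕ → Set X := fun n => t ⁻¹' Metric.ball (b n) (ε / 2)
  refine ⟨disjointed B, s, fun n => MeasurableSet.disjointed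
    (fun n => ht measurableSet_ball) n, disjoint_disjointed B, ?_,
    fun n => ⟨hsm n, hsE n⟩, fun n => .of_forall fun x hx => ?_⟩
  · rw [iUnion_disjointed, eq_univ_iff_forall]
    intro x
    obtain ⟨n, hn⟩ := hb.exists_dist_lt (t x) (half_pos hε)
    exact mem_iUnion.2 ⟨n, hn⟩
  · have hxB : t x ∈ Metric.ball (b n) (ε / 2) := disjointed_subset B n hx
    have hsx := Metric.closure_ball_subset_closedBall (hs n (φ x) ⟨t x, htE x, hxB⟩)
    rw [← dist_eq_norm]
    have h₁ := Metric.mem_ball.1 hxB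
    have h₂ := Metric.mem_closedBall.1 hsx
    linarith [dist_triangle_right (t x) (s n (φ x)) (b n)]
end
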